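/- arXiv:2601.11216 — 2 statements merged into one kernel-verified Lean document; each statement's English description precedes it below -/
import Mathlib

section
/- Let α∈(0,1) and θ∈ℝ with α+θ>0, and let (K_n,(K_{r,n})_{r≥1}) be the Ewens–Pitman block-counting chain with parameters (α,θ). Then the estimator α̂_n = K_{1,n}/K_n converges to α almost surely as n→∞. -/
open MeasureTheory ProbabilityTheory Filter Topology

noncomputable section

/-- Rising factorial `(a)^(m) = a (a+1) ⋯ (a+m-1)` of a real number. -/
def risingFactorial (a : ℝ) : ℕ → ℝ
  | 0 => 1
  | m + 1 => risingFactorial a m * (a + m)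

/-- Sibuya probabilities `p_α(r) = α (1-α)^(r-1) / r!` for `r ≥ 1`. -/
def sibuya (α : ℝ) (r : ℕ) : ℝ :=
  α * risingFactorial (1 - α) (r - 1) / (Nat.factorial r : ℝ)

/-- The Ewens–Pitman block-counting chain with parameters `(α, θ)` on a probability space
`(Ω, μ)` with filtration `F`: for `n ≥ 1`, `K n` is the number of blocks and `B r n` the
number of blocks of size `r` of the Ewens–Pitman random partition of `{1,…,n}`.
It starts from `K 1 = 1`, `B 1 1 = 1`, `B r 1 = 0` for `r ≥ 2`, and the transition from
time `n` to `n+1` creates a new block with conditional probability `(α K n + θ)/(n + θ)`,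
and grows a block of size `r` to size `r+1` with conditional probability
`(r - α) B r n / (n + θ)`. -/
structure IsEwensPitman (α θ : ℝ) {Ω : Type*} {mΩ : MeasurableSpace Ω}
    (μ : Measure Ω) (F : Filtration ℕ mΩ) (K : ℕ → Ω → ℕ) (B : ℕ → ℕ → Ω → ℕ) :
    Prop where
  prob : IsProbabilityMeasure μ
  meas_K : ∀ n, Measurable[F n] (K n)
  meas_B : ∀ r n, Measurable[F n] (B r n)
  init_K : ∀ᵐ ω ∂μ, K 1 ω = 1
  init_B1 : ∀ᵐ ω ∂μ, B 1 1 ω = 1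
  init_B : ∀ r, 2 ≤ r → ∀ᵐ ω ∂μ, B r 1 ω = 0
  B_eq_zero : ∀ r n, n < r → ∀ᵐ ω ∂μ, B r n ω = 0
  sum_blocks : ∀ n, 1 ≤ n → ∀ᵐ ω ∂μ, K n ω = ∑ r ∈ Finset.Icc 1 n, B r n ω
  sum_sizes : ∀ n, 1 ≤ n → ∀ᵐ ω ∂μ, n = ∑ r ∈ Finset.Icc 1 n, r * B r n ω
  trans_new : ∀ n, 1 ≤ n →
    μ[Set.indicator {ω | K (n+1) ω = K n ω + 1 ∧ B 1 (n+1) ω = B 1 n ω + 1 ∧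
        ∀ s, 2 ≤ s → B s (n+1) ω = B s n ω} (fun _ => (1:ℝ)) | F n]
      =ᵐ[μ] fun ω => (α * (K n ω : ℝ) + θ) / ((n : ℝ) + θ)
  trans_grow : ∀ n, 1 ≤ n → ∀ r, 1 ≤ r →
    μ[Set.indicator {ω | K (n+1) ω = K n ω ∧ B r (n+1) ω + 1 = B r n ω ∧
        B (r+1) (n+1) ω = B (r+1) n ω + 1 ∧
        ∀ s, 1 ≤ s → s ≠ r → s ≠ r + 1 → B s (n+1) ω = B s n ω} (fun _ => (1:ℝ)) | F n]
      =ᵐ[μ] fun ω => (((r : ℝ) - α) * (B r n ω : ℝ)) / ((n : ℝ) + θ)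


def evNew {Ω : Type*} (K : ℕ → Ω → ℕ) (B : ℕ → ℕ → Ω → ℕ) (n : ℕ) : Set Ω :=
  {ω | K (n+1) ω = K n ω + 1 ∧ B 1 (n+1) ω = B 1 n ω + 1 ∧
        ∀ s, 2 ≤ s → B s (n+1) ω = B s n ω}

def evGrow {Ω : Type*} (K : ℕ → Ω → ℕ) (B : ℕ → ℕ → Ω → ℕ) (n r : ℕ) : Set Ω :=
  {ω | K (n+1) ω = K n ω ∧ B r (n+1) ω + 1 = B r n ω ∧
        B (r+1) (n+1) ω = B (r+1) n ω + 1 ∧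
        ∀ s, 1 ≤ s → s ≠ r → s ≠ r + 1 → B s (n+1) ω = B s n ω}

section
variable {α θ : ℝ} {Ω : Type*} [mΩ : MeasurableSpace Ω] {μ : Measure Ω} {F : Filtration ℕ mΩ}
    {K : ℕ → Ω → ℕ} {B : ℕ → ℕ → Ω → ℕ}

lemma meas_evNew (h : IsEwensPitman α θ μ F K B) (n : ℕ) : MeasurableSet (evNew K B n) := by
  have hK : ∀ n, Measurable (K n) := fun n => (h.meas_K n).mono (F.le n) le_rfl
  have hB : ∀ r n, Measurable (B r n) := fun r n => (h.meas_B r n).mono (F.le n) le_rfl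
  have : evNew K B n = {ω | K (n+1) ω = K n ω + 1} ∩ ({ω | B 1 (n+1) ω = B 1 n ω + 1} ∩
      ⋂ s, ⋂ (_ : 2 ≤ s), {ω | B s (n+1) ω = B s n ω}) := by
    ext ω; simp [evNew]
  rw [this]
  refine (measurableSet_eq_fun (hK _) ((hK _).add_const 1)).inter
    ((measurableSet_eq_fun (hB _ _) ((hB _ _).add_const 1)).inter ?_)
  exact MeasurableSet.iInter fun s => MeasurableSet.iInter fun _ =>
    measurableSet_eq_fun (hB _ _) (hB _ _)

lemma meas_evGrow (h : IsEwensPitman α θ μ F K B) (n r : ℕ) :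
    MeasurableSet (evGrow K B n r) := by
  have hK : ∀ n, Measurable (K n) := fun n => (h.meas_K n).mono (F.le n) le_rfl
  have hB : ∀ r n, Measurable (B r n) := fun r n => (h.meas_B r n).mono (F.le n) le_rfl
  have : evGrow K B n r = {ω | K (n+1) ω = K n ω} ∩ ({ω | B r (n+1) ω + 1 = B r n ω} ∩
      ({ω | B (r+1) (n+1) ω = B (r+1) n ω + 1} ∩
      ⋂ s, ⋂ (_ : 1 ≤ s), ⋂ (_ : s ≠ r), ⋂ (_ : s ≠ r + 1), {ω | B s (n+1) ω = B s n ω})) := by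
    ext ω; simp [evGrow]
  rw [this]
  refine (measurableSet_eq_fun (hK _) (hK _)).inter
    ((measurableSet_eq_fun ((hB _ _).add_const 1) (hB _ _)).inter
    ((measurableSet_eq_fun (hB _ _) ((hB _ _).add_const 1)).inter ?_))
  exact MeasurableSet.iInter fun s => MeasurableSet.iInter fun _ =>
    MeasurableSet.iInter fun _ => MeasurableSet.iInter fun _ =>
    measurableSet_eq_fun (hB _ _) (hB _ _)

/-- Basic a.s. bounds. -/
lemma ae_bounds (h : IsEwensPitman α θ μ F K B) (n : ℕ) (hn : 1 ≤ n) :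
    ∀ᵐ ω ∂μ, 1 ≤ K n ω ∧ K n ω ≤ n ∧ B 1 n ω ≤ K n ω := by
  filter_upwards [h.sum_blocks n hn, h.sum_sizes n hn] with ω h1 h2
  have h3 : K n ω ≤ n := by
    rw [h1]; conv_rhs => rw [h2]
    refine Finset.sum_le_sum fun r hr => ?_
    exact Nat.le_mul_of_pos_left _ (by simp at hr; omega)
  refine ⟨?_, h3, ?_⟩
  · by_contra hc
    have h0 : K n ω = 0 := by omega
    rw [h0] at h1
    have h4 := Finset.sum_eq_zero_iff.1 h1.symm
    rw [Finset.sum_eq_zero (fun r hr => by rw [h4 r hr, mul_zero])] at h2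
    omega
  · rw [h1]
    exact Finset.single_le_sum (f := fun r => B r n ω) (fun _ _ => Nat.zero_le _)
      (by simp; omega)

lemma smeas_fun (h : IsEwensPitman α θ μ F K B) (g : ℕ → ℕ → ℝ) (n : ℕ) :
    StronglyMeasurable[F n] (fun ω => g (K n ω) (B 1 n ω)) := by
  have : Measurable[F n] (fun ω => g (K n ω) (B 1 n ω)) :=
    (measurable_of_countable (fun p : ℕ × ℕ => g p.1 p.2)).comp
      ((h.meas_K n).prodMk (h.meas_B 1 n))
  exact this.stronglyMeasurable

lemma fun_bdd (h : IsEwensPitman α θ μ F K B) (g : ℕ → ℕ → ℝ) (n : ℕ) (hn : 1 ≤ n) :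
    ∃ C : ℝ, ∀ᵐ ω ∂μ, ‖g (K n ω) (B 1 n ω)‖ ≤ C := by
  refine ⟨∑ p ∈ Finset.range (n+1) ×ˢ Finset.range (n+1), ‖g p.1 p.2‖, ?_⟩
  filter_upwards [ae_bounds h n hn] with ω ⟨h1, h2, h3⟩
  exact Finset.single_le_sum (f := fun p : ℕ × ℕ => ‖g p.1 p.2‖) (fun _ _ => norm_nonneg _)
    (a := (K n ω, B 1 n ω)) (by simp; omega)

lemma fun_int (h : IsEwensPitman α θ μ F K B) (g : ℕ → ℕ → ℝ) (n : ℕ) (hn : 1 ≤ n) :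
    Integrable (fun ω => g (K n ω) (B 1 n ω)) μ := by
  have := h.prob
  obtain ⟨C, hC⟩ := fun_bdd h g n hn
  exact Integrable.of_bound ((smeas_fun h g n).mono (F.le n)).aestronglyMeasurable C hC

def iNew (K : ℕ → Ω → ℕ) (B : ℕ → ℕ → Ω → ℕ) (n : ℕ) : Ω → ℝ :=
  (evNew K B n).indicator (fun _ => (1:ℝ))
def iGrow (K : ℕ → Ω → ℕ) (B : ℕ → ℕ → Ω → ℕ) (n r : ℕ) : Ω → ℝ :=
  (evGrow K B n r).indicator (fun _ => (1:ℝ))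

lemma int_iNew (h : IsEwensPitman α θ μ F K B) (n : ℕ) : Integrable (iNew K B n) μ := by
  have := h.prob
  exact (integrable_const _).indicator (meas_evNew h n)

lemma int_iGrow (h : IsEwensPitman α θ μ F K B) (n r : ℕ) : Integrable (iGrow K B n r) μ := by
  have := h.prob
  exact (integrable_const _).indicator (meas_evGrow h n r)

lemma iNew_nonneg (n : ℕ) (ω : Ω) : 0 ≤ iNew K B n ω :=
  Set.indicator_nonneg (fun _ _ => zero_le_one) _
lemma iGrow_nonneg (n r : ℕ) (ω : Ω) : 0 ≤ iGrow K B n r ω :=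
  Set.indicator_nonneg (fun _ _ => zero_le_one) _

lemma total_le_one (n : ℕ) (ω : Ω) :
    iNew K B n ω + ∑ r ∈ Finset.Icc 1 n, iGrow K B n r ω ≤ 1 := by
  by_cases h1 : ω ∈ evNew K B n
  · have : ∑ r ∈ Finset.Icc 1 n, iGrow K B n r ω = 0 := by
      refine Finset.sum_eq_zero fun r _ => Set.indicator_of_notMem ?_ _
      intro h2
      have a := h1.1
      have b := h2.1
      omega
    rw [this, iNew, Set.indicator_of_mem h1]; norm_num
  · rw [iNew, Set.indicator_of_notMem h1, zero_add]
    by_cases h2 : ∃ r ∈ Finset.Icc 1 n, ω ∈ evGrow K B n r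
    · obtain ⟨r, hr, h2⟩ := h2
      rw [Finset.sum_eq_single_of_mem r hr, iGrow, Set.indicator_of_mem h2]
      intro s hs hsr
      refine Set.indicator_of_notMem ?_ _
      intro h3
      simp at hr hs
      rcases lt_or_gt_of_ne hsr with hlt | hlt
      · have a := h2.2.2.2 s (by omega) (by omega) (by omega)
        have b := h3.2.1
        omega
      · have a := h3.2.2.2 r (by omega) (by omega) (by omega)
        have b := h2.2.1
        omega
    · push Not at h2
      rw [Finset.sum_eq_zero fun r hr => show iGrow K B n r ω = 0 from
        Set.indicator_of_notMem (h2 r hr) _]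
      norm_num

lemma sum_prob (hθ : 0 < 1 + θ) {n : ℕ} (hn : 1 ≤ n) {k : ℕ} {b : ℕ → ℕ}
    (h1 : k = ∑ r ∈ Finset.Icc 1 n, b r) (h2 : n = ∑ r ∈ Finset.Icc 1 n, r * b r) :
    (α * (k : ℝ) + θ) / ((n : ℝ) + θ) +
      ∑ r ∈ Finset.Icc 1 n, (((r : ℝ) - α) * (b r : ℝ)) / ((n : ℝ) + θ) = 1 := by
  have hn' : (1:ℝ) ≤ n := by exact_mod_cast hn
  have hN : (n:ℝ) + θ ≠ 0 := by linarith
  rw [← Finset.sum_div, ← add_div, div_eq_one_iff_eq hN]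
  have h1' : (k:ℝ) = ∑ r ∈ Finset.Icc 1 n, (b r : ℝ) := by exact_mod_cast h1
  have h2' : (n:ℝ) = ∑ r ∈ Finset.Icc 1 n, (r:ℝ) * (b r : ℝ) := by exact_mod_cast h2
  simp_rw [sub_mul]
  rw [Finset.sum_sub_distrib, ← Finset.mul_sum, ← h1', ← h2']
  ring

lemma total_eq_one (h : IsEwensPitman α θ μ F K B) (hθ : 0 < 1 + θ) (n : ℕ) (hn : 1 ≤ n) :
    ∀ᵐ ω ∂μ, iNew K B n ω + ∑ r ∈ Finset.Icc 1 n, iGrow K B n r ω = 1 := by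
  have := h.prob
  set S : Ω → ℝ := iNew K B n + ∑ r ∈ Finset.Icc 1 n, iGrow K B n r with hS
  have hSi : Integrable S μ :=
    (int_iNew h n).add (integrable_finsetSum' _ fun r _ => int_iGrow h n r)
  have hSa : ∀ ω, S ω = iNew K B n ω + ∑ r ∈ Finset.Icc 1 n, iGrow K B n r ω := by
    intro ω; simp [hS]
  have hg : ∀ᵐ ω ∂μ, ∀ r ∈ Finset.Icc 1 n, (μ[iGrow K B n r | F n]) ω =
      (((r : ℝ) - α) * (B r n ω : ℝ)) / ((n : ℝ) + θ) := by
    rw [ae_all_iff]; intro r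
    by_cases hr : r ∈ Finset.Icc 1 n
    · filter_upwards [h.trans_grow n hn r (Finset.mem_Icc.1 hr).1] with ω hω _ using hω
    · exact ae_of_all _ fun ω hh => absurd hh hr
  have hc : μ[S | F n] =ᵐ[μ] fun _ => (1:ℝ) := by
    filter_upwards [condExp_add (int_iNew h n)
      (integrable_finsetSum' (Finset.Icc 1 n) fun r _ => int_iGrow h n r) (F n),
      condExp_finsetSum (s := Finset.Icc 1 n) (fun r _ => int_iGrow h n r) (F n),
      h.trans_new n hn, hg, h.sum_blocks n hn, h.sum_sizes n hn] with ω a1 a2 a3 a4 a5 a6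
    rw [hS, a1, Pi.add_apply, a2, Finset.sum_apply, Finset.sum_congr rfl a4]
    change (μ[iNew K B n | F n]) ω = _ at a3
    rw [a3]
    exact sum_prob hθ hn a5 a6
  have hI : ∫ ω, S ω ∂μ = 1 := by
    rw [← integral_condExp (F.le n), integral_congr_ae hc]; simp
  have h0 : ∫ ω, (1 - S ω) ∂μ = 0 := by
    rw [integral_sub (integrable_const _) hSi, hI]; simp
  have h1 := (integral_eq_zero_iff_of_nonneg (fun ω => by
    have := total_le_one (K := K) (B := B) n ω
    rw [← hSa] at this
    simpa using this) ((integrable_const _).sub hSi)).1 h0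
  filter_upwards [h1] with ω hω
  rw [← hSa]
  simp at hω
  linarith

lemma step_le (h : IsEwensPitman α θ μ F K B) (hθ : 0 < 1 + θ) (n : ℕ) (hn : 1 ≤ n)
    (g : ℕ → ℕ → ℝ) (g2 : ℕ → ℕ → ℝ) (hg : ∀ k, 1 ≤ k → ∀ x, 0 ≤ g k x)
    (hg2 : ∀ k x, g2 k (x+1) = g k x) (hg2n : ∀ k, 1 ≤ k → ∀ x, 0 ≤ g2 k x) :
    μ[fun ω => g (K (n+1) ω) (B 1 (n+1) ω) | F n] ≤ᵐ[μ] fun ω =>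
      g (K n ω) (B 1 n ω) + (1 / ((n:ℝ) + θ)) *
      ((α * K n ω + θ) * (g (K n ω + 1) (B 1 n ω + 1) - g (K n ω) (B 1 n ω)) +
        (1 - α) * B 1 n ω * (g2 (K n ω) (B 1 n ω) - g (K n ω) (B 1 n ω))) := by
  have := h.prob
  set f1 : Ω → ℝ := fun ω => g (K n ω + 1) (B 1 n ω + 1) with hf1
  set f2 : Ω → ℝ := fun ω => g2 (K n ω) (B 1 n ω) with hf2
  set f : Ω → ℝ := fun ω => g (K n ω) (B 1 n ω) with hf
  set T : Ω → ℝ := ∑ r ∈ Finset.Icc 2 n, iGrow K B n r with hT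
  have mf1 : StronglyMeasurable[F n] f1 := smeas_fun h (fun k x => g (k+1) (x+1)) n
  have mf2 : StronglyMeasurable[F n] f2 := smeas_fun h g2 n
  have mf : StronglyMeasurable[F n] f := smeas_fun h g n
  obtain ⟨C1, hC1⟩ := fun_bdd h (fun k x => g (k+1) (x+1)) n hn
  obtain ⟨C2, hC2⟩ := fun_bdd h g2 n hn
  obtain ⟨C, hC⟩ := fun_bdd h g n hn
  have iT : Integrable T μ := integrable_finsetSum' _ fun r _ => int_iGrow h n r
  have i1 : Integrable (f1 * iNew K B n) μ :=
    (int_iNew h n).bdd_mul (mf1.mono (F.le n)).aestronglyMeasurable hC1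
  have i2 : Integrable (f2 * iGrow K B n 1) μ :=
    (int_iGrow h n 1).bdd_mul (mf2.mono (F.le n)).aestronglyMeasurable hC2
  have i3 : Integrable (f * T) μ :=
    iT.bdd_mul (mf.mono (F.le n)).aestronglyMeasurable hC
  have hIcc : Finset.Icc 1 n = insert 1 (Finset.Icc 2 n) := by
    ext x; simp; omega
  have hdom : (fun ω => g (K (n+1) ω) (B 1 (n+1) ω)) ≤ᵐ[μ]
      f1 * iNew K B n + f2 * iGrow K B n 1 + f * T := by
    filter_upwards [total_eq_one h hθ n hn, ae_bounds h n hn] with ω h1 ⟨h2, _, _⟩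
    have hTn : 0 ≤ T ω := by
      rw [hT, Finset.sum_apply]; exact Finset.sum_nonneg fun r _ => iGrow_nonneg n r ω
    have p1 : 0 ≤ f1 ω * iNew K B n ω :=
      mul_nonneg (hg _ (by omega) _) (iNew_nonneg n ω)
    have p2 : 0 ≤ f2 ω * iGrow K B n 1 ω :=
      mul_nonneg (hg2n _ h2 _) (iGrow_nonneg n 1 ω)
    have p3 : 0 ≤ f ω * T ω := mul_nonneg (hg _ h2 _) hTn
    simp only [Pi.add_apply, Pi.mul_apply]
    by_cases e1 : ω ∈ evNew K B n
    · have : iNew K B n ω = 1 := Set.indicator_of_mem e1 _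
      have e : g (K (n+1) ω) (B 1 (n+1) ω) = f1 ω := by rw [e1.1, e1.2.1]
      rw [this] at p1 ⊢
      linarith
    by_cases e2 : ω ∈ evGrow K B n 1
    · have : iGrow K B n 1 ω = 1 := Set.indicator_of_mem e2 _
      have e : g (K (n+1) ω) (B 1 (n+1) ω) = f2 ω := by
        simp only [hf2]; rw [e2.1, ← e2.2.1, hg2]
      rw [this] at p2 ⊢
      linarith
    have z1 : iNew K B n ω = 0 := Set.indicator_of_notMem e1 _
    have z2 : iGrow K B n 1 ω = 0 := Set.indicator_of_notMem e2 _
    have hT1 : T ω = 1 := by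
      rw [z1, hIcc, Finset.sum_insert (by simp), z2] at h1
      rw [hT, Finset.sum_apply]; linarith
    have : ∃ r ∈ Finset.Icc 2 n, ω ∈ evGrow K B n r := by
      by_contra hcon
      push Not at hcon
      rw [hT, Finset.sum_apply,
        Finset.sum_eq_zero fun r hr => show iGrow K B n r ω = 0 from
          Set.indicator_of_notMem (hcon r hr) _] at hT1
      norm_num at hT1
    obtain ⟨r, hr, hr2⟩ := this
    simp at hr
    have e : g (K (n+1) ω) (B 1 (n+1) ω) = f ω := by
      rw [hr2.1, hr2.2.2.2 1 le_rfl (by omega) (by omega)]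
    rw [z1, z2, hT1, e]; simp
  have hgr : ∀ᵐ ω ∂μ, ∀ r ∈ Finset.Icc 2 n, (μ[iGrow K B n r | F n]) ω =
      (((r : ℝ) - α) * (B r n ω : ℝ)) / ((n : ℝ) + θ) := by
    rw [ae_all_iff]; intro r
    by_cases hr : r ∈ Finset.Icc 2 n
    · filter_upwards [h.trans_grow n hn r (by simp at hr; omega)] with ω hω _ using hω
    · exact ae_of_all _ fun ω hh => absurd hh hr
  filter_upwards [condExp_mono (m := F n) (fun_int h g (n+1) (by omega)) ((i1.add i2).add i3) hdom,
    condExp_add (i1.add i2) i3 (F n), condExp_add i1 i2 (F n),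
    condExp_mul_of_stronglyMeasurable_left mf1 i1 (int_iNew h n),
    condExp_mul_of_stronglyMeasurable_left mf2 i2 (int_iGrow h n 1),
    condExp_mul_of_stronglyMeasurable_left mf i3 iT,
    condExp_finsetSum (s := Finset.Icc 2 n) (fun r _ => int_iGrow h n r) (F n),
    h.trans_new n hn, h.trans_grow n hn 1 le_rfl, hgr, h.sum_blocks n hn, h.sum_sizes n hn]
    with ω a1 a2 a3 a4 a5 a6 a7 a8 a9 a10 a11 a12
  change (μ[iNew K B n | F n]) ω = _ at a8
  change (μ[iGrow K B n 1 | F n]) ω = _ at a9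
  have sp := sum_prob (α := α) hθ hn a11 a12
  rw [hIcc, Finset.sum_insert (by simp)] at sp
  rw [a2, Pi.add_apply, a3, Pi.add_apply, a4, a5, a6, Pi.mul_apply, Pi.mul_apply, Pi.mul_apply,
    a7, Finset.sum_apply, Finset.sum_congr rfl a10, a8, a9] at a1
  refine a1.trans (le_of_eq ?_)
  have e3 : ∑ r ∈ Finset.Icc 2 n, (((r : ℝ) - α) * (B r n ω : ℝ)) / ((n : ℝ) + θ) =
    1 - (α * (K n ω : ℝ) + θ) / ((n : ℝ) + θ) -
     (((1 : ℕ) : ℝ) - α) * (B 1 n ω : ℝ) / ((n : ℝ) + θ) := by linarith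
  rw [e3]
  simp only [hf1, hf2, hf]
  push_cast
  ring

end

def wfun (α A Y X : ℝ) : ℝ := (X / Y - α)^2 + A / Y

set_option maxHeartbeats 2000000 in
lemma wfun_drift (α y0 M : ℝ) (hα0 : 0 < α) (hα1 : α < 1) (hy : 0 < y0) (hM : 0 ≤ M) :
    ∃ A c : ℝ, 0 < A ∧ 0 < c ∧ ∀ Y X : ℝ, y0 ≤ Y → 0 ≤ X → X ≤ M * Y →
      α * Y * (wfun α A (Y+1) (X+1) - wfun α A Y X)
        + (1 - α) * X * (wfun α A Y (X-1) - wfun α A Y X) ≤ - c * wfun α A Y X := by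
  set δ := y0 / (1 + y0) with hδ
  have hδ0 : 0 < δ := by positivity
  have hδ1 : δ < 1 := by rw [hδ, div_lt_one (by positivity)]; linarith
  set C : ℝ := α * (4 * (M + 1) + 4 * (M+1)^2 + 1) + M + 1 with hC
  have hC0 : 0 < C := by positivity
  refine ⟨2 * C / (α * δ), α * δ / 2, by positivity, by positivity, ?_⟩
  intro Y X hY hX0 hX
  have hY0 : 0 < Y := by linarith
  set A := 2 * C / (α * δ) with hA
  have hA0 : 0 < A := by positivity
  have hAC : A * (α * δ) = 2 * C := by rw [hA]; field_simp
  obtain ⟨x, rfl⟩ : ∃ x, X = x * Y := ⟨X / Y, by field_simp⟩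
  have hx0 : 0 ≤ x := by
    by_contra h
    push Not at h
    nlinarith
  have hxM : x ≤ M := le_of_mul_le_mul_right hX hY0
  obtain ⟨z, rfl⟩ : ∃ z, x = z + α := ⟨x - α, by ring⟩
  have hz : |z| ≤ M + 1 := by rw [abs_le]; constructor <;> linarith
  have hz2 : z^2 ≤ (M+1)^2 := by rw [← sq_abs]; gcongr
  -- quadratic part
  have h1 : α * Y * (((z+α) * Y + 1) / (Y+1) - α)^2 - α * Y * z^2
      ≤ α * (2 * (1-α) * z - 2 * z^2) + α * (4 * (M + 1) + 4 * (M+1)^2 + 1) / Y := by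
    have e : ((z+α) * Y + 1) / (Y+1) - α = (z * Y + (1 - α)) / (Y + 1) := by
      field_simp; ring
    rw [e]
    have e2 : α * Y * ((z * Y + (1 - α)) / (Y + 1))^2 - α * Y * z^2
      = α * (2 * (1-α) * z - 2 * z^2) + α * (((1-α)^2 - z^2) * Y -
          (2 * (1-α) * z - 2 * z^2) * (2 * Y + 1)) / (Y+1)^2 := by
      field_simp; ring
    rw [e2]
    refine add_le_add le_rfl ?_
    rw [div_le_div_iff₀ (by positivity) hY0, mul_assoc α, mul_assoc α]
    refine mul_le_mul_of_nonneg_left ?_ hα0.le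
    have hb : (1-α)^2 ≤ 1 := by nlinarith
    have hbz : |(1-α) * z| ≤ M + 1 := by
      rw [abs_mul, abs_of_pos (by linarith : 0 < 1 - α)]
      nlinarith [abs_nonneg z]
    have hbz' := neg_le_of_abs_le hbz
    have i1 : ((1-α)^2 - z^2) * Y - (2 * (1-α) * z - 2 * z^2) * (2 * Y + 1)
       ≤ 1 * Y + (2 * (M+1) + 2 * (M+1)^2) * (2*Y+1) := by
      have : ((1-α)^2 - z^2) * Y ≤ 1 * Y := by
        exact mul_le_mul_of_nonneg_right (by nlinarith [sq_nonneg z]) hY0.le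
      have : -(2 * (1-α) * z - 2 * z^2) * (2 * Y + 1) ≤ (2 * (M+1) + 2 * (M+1)^2) * (2*Y+1) := by
        exact mul_le_mul_of_nonneg_right (by linarith) (by linarith)
      linarith
    calc _ ≤ (1 * Y + (2 * (M+1) + 2 * (M+1)^2) * (2*Y+1)) * Y :=
        mul_le_mul_of_nonneg_right i1 hY0.le
      _ ≤ _ := by
        have : 0 ≤ M * Y := by positivity
        have : 0 ≤ M^2 * Y := by positivity
        have : 0 ≤ M^2 * Y^2 := by positivity
        have : 0 ≤ M * Y^2 := by positivity
        nlinarith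
  have h2 : (1 - α) * ((z+α) * Y) * ((((z+α)*Y - 1) / Y - α)^2 - z^2)
      ≤ (1-α) * (-2*z^2 - 2 * α * z) + (M+1) / Y := by
    have e : (1 - α) * ((z+α) * Y) * ((((z+α)*Y - 1) / Y - α)^2 - z^2)
      = (1-α) * (-2*z^2 - 2 * α * z) + (1-α) * (z+α) / Y := by
      field_simp; ring
    rw [e]
    have : (1-α) * (z+α) / Y ≤ (M+1) / Y :=
      div_le_div_of_nonneg_right (by nlinarith) hY0.le
    linarith
  have h3 : α * Y * (A / (Y+1) - A / Y) ≤ - (2 * C) / Y := by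
    have e : α * Y * (A / (Y+1) - A / Y) = - (α * A * (Y / (Y+1))) / Y := by
      field_simp; ring
    rw [e]
    have : δ ≤ Y / (Y+1) := by
      rw [hδ, div_le_div_iff₀ (by positivity) (by positivity)]; nlinarith
    have : α * A * δ ≤ α * A * (Y/(Y+1)) := by gcongr
    exact div_le_div_of_nonneg_right (by linarith) hY0.le
  have e0 : (z + α) * Y / Y - α = z := by field_simp; ring
  unfold wfun
  rw [e0]
  have h4 : α * (4 * (M + 1) + 4 * (M+1)^2 + 1) / Y + (M+1) / Y = C / Y := by
    rw [hC]; ring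
  have h5 : α * δ / 2 * (A / Y) = C / Y := by
    rw [← mul_div_assoc]; congr 1; linarith
  have h6 : α * δ / 2 * z^2 ≤ 2 * z^2 := by
    refine mul_le_mul_of_nonneg_right ?_ (sq_nonneg z)
    nlinarith
  have h7 : -(2*C)/Y = - 2 * (C/Y) := by ring
  linarith

lemma prod_tendsto (θ c : ℝ) (hθ : 0 < 1 + θ) (hc : 0 < c) :
    Tendsto (fun n : ℕ => ∏ j ∈ Finset.range n, (1 + c / ((j:ℝ) + 1 + θ))) atTop atTop := by
  have key : ∀ n : ℕ, 1 + ∑ j ∈ Finset.range n, c / ((j:ℝ) + 1 + θ) ≤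
      ∏ j ∈ Finset.range n, (1 + c / ((j:ℝ) + 1 + θ)) := by
    intro n
    induction n with
    | zero => simp
    | succ n ih =>
      rw [Finset.sum_range_succ, Finset.prod_range_succ]
      have h0 : 0 < c / ((n:ℝ) + 1 + θ) := by
        have : (0:ℝ) ≤ n := by positivity
        apply div_pos hc; linarith
      have h1 : 1 ≤ ∏ j ∈ Finset.range n, (1 + c / ((j:ℝ) + 1 + θ)) := by
        refine le_trans ?_ ih
        have : 0 ≤ ∑ j ∈ Finset.range n, c / ((j:ℝ) + 1 + θ) := by
          apply Finset.sum_nonneg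
          intro j _
          have : (0:ℝ) ≤ j := by positivity
          apply div_nonneg hc.le; linarith
        linarith
      nlinarith
  refine tendsto_atTop_mono key ?_
  apply tendsto_atTop_add_const_left
  have hd : ¬ Summable (fun j : ℕ => c / ((j:ℝ) + 1 + θ)) := by
    intro h
    obtain ⟨m, hm⟩ := exists_nat_gt |θ|
    have hm2 := abs_lt.1 hm
    have : Summable (fun j : ℕ => ((m:ℝ)+1)/c * (c / ((j:ℝ) + 1 + θ))) := h.mul_left _
    have h2 : Summable (fun j : ℕ => 1 / ((j+1 : ℕ) : ℝ)) := by
      refine Summable.of_nonneg_of_le (fun j => by positivity) (fun j => ?_) this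
      have hj : (0:ℝ) ≤ j := by positivity
      have hp : 0 < (j:ℝ) + 1 + θ := by linarith
      have : ((m:ℝ)+1)/c * (c / ((j:ℝ) + 1 + θ)) = (m+1) / ((j:ℝ) + 1 + θ) := by field_simp
      rw [this, div_le_div_iff₀ (by positivity) hp]
      push_cast
      nlinarith [mul_nonneg hj (Nat.cast_nonneg (α := ℝ) m), Nat.cast_nonneg (α := ℝ) m]
    rw [summable_nat_add_iff 1 (f := fun j : ℕ => 1 / (j : ℝ))] at h2
    exact Real.not_summable_one_div_natCast h2
  refine (not_summable_iff_tendsto_nat_atTop_of_nonneg ?_).1 hd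
  intro j
  have : (0:ℝ) ≤ j := by positivity
  apply div_nonneg hc.le; linarith

/-- Strong consistency of `α̂_n = K_{1,n}/K_n`: it converges to `α` almost surely. -/
theorem estimator_ae_tendsto (α θ : ℝ) (hα0 : 0 < α) (hα1 : α < 1) (hθ : 0 < α + θ)
    {Ω : Type*} [mΩ : MeasurableSpace Ω] (μ : Measure Ω) (F : Filtration ℕ mΩ)
    (K : ℕ → Ω → ℕ) (B : ℕ → ℕ → Ω → ℕ) (hEP : IsEwensPitman α θ μ F K B) :
    ∀ᵐ ω ∂μ, Tendsto (fun n => (B 1 n ω : ℝ) / (K n ω : ℝ)) atTop (𝓝 α) := by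
  have hp := hEP.prob
  have hθ1 : 0 < 1 + θ := by linarith
  set c := θ / α with hc
  have hαc : α * c = θ := by rw [hc]; field_simp
  have hy0 : 0 < 1 + c := by
    have : 0 < α * (1 + c) := by rw [mul_add, hαc]; linarith
    exact pos_of_mul_pos_right this hα0.le
  set M : ℝ := 1 + |c| / (1 + c) with hM
  have hM0 : 0 ≤ M := by positivity
  obtain ⟨A, d, hA, hd, hdrift⟩ := wfun_drift α (1+c) M hα0 hα1 hy0 hM0
  set g : ℕ → ℕ → ℝ := fun k x => wfun α A (k + c) x with hg
  set g2 : ℕ → ℕ → ℝ := fun k x => wfun α A (k + c) (x - 1) with hg2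
  have hYk : ∀ k : ℕ, 1 ≤ k → 1 + c ≤ (k:ℝ) + c := by
    intro k hk
    have : (1:ℝ) ≤ k := by exact_mod_cast hk
    linarith
  have wn : ∀ Y X : ℝ, 0 < Y → 0 ≤ wfun α A Y X := by
    intro Y X hY
    unfold wfun; positivity
  have hgn : ∀ k, 1 ≤ k → ∀ x, 0 ≤ g k x := fun k hk x => wn _ _ (hy0.trans_le (hYk k hk))
  have hg2n : ∀ k, 1 ≤ k → ∀ x, 0 ≤ g2 k x := fun k hk x => wn _ _ (hy0.trans_le (hYk k hk))
  have hg2e : ∀ k x, g2 k (x+1) = g k x := by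
    intro k x; simp [hg, hg2]
  set W : ℕ → Ω → ℝ := fun n ω => g (K n ω) (B 1 n ω) with hW
  have hstep : ∀ n, 1 ≤ n → μ[W (n+1) | F n] ≤ᵐ[μ] fun ω => (1 - d / ((n:ℝ) + θ)) * W n ω := by
    intro n hn
    filter_upwards [step_le hEP hθ1 n hn g g2 hgn hg2e hg2n, ae_bounds hEP n hn]
      with ω h1 ⟨h2, h3, h4⟩
    refine h1.trans ?_
    have hn' : (1:ℝ) ≤ n := by exact_mod_cast hn
    have hN : 0 < (n:ℝ) + θ := by linarith
    have hY := hYk _ h2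
    have hX : (B 1 n ω : ℝ) ≤ M * (K n ω + c) := by
      have h4' : (B 1 n ω : ℝ) ≤ K n ω := by exact_mod_cast h4
      have h5 : |c| ≤ |c| / (1 + c) * (K n ω + c) := by
        calc |c| = |c| / (1 + c) * (1 + c) := by field_simp
          _ ≤ _ := by gcongr
      have := neg_abs_le c
      rw [hM, add_mul]
      linarith
    have hh := hdrift _ _ hY (Nat.cast_nonneg _) hX
    have e1 : g (K n ω + 1) (B 1 n ω + 1) = wfun α A (K n ω + c + 1) (B 1 n ω + 1) := by
      simp only [hg]; push_cast; congr 1; ring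
    have e2 : α * K n ω + θ = α * (K n ω + c) := by rw [mul_add, hαc]
    rw [e1, e2]
    have := mul_le_mul_of_nonneg_left hh (by positivity : 0 ≤ 1 / ((n:ℝ) + θ))
    calc _ ≤ W n ω + 1 / ((n:ℝ) + θ) * (-d * W n ω) := by
          exact add_le_add le_rfl this
      _ = _ := by ring
  set G : ℕ → ℝ := fun m => ∏ j ∈ Finset.range m, (1 + d / ((j:ℝ) + 1 + θ)) with hG
  have hGt : Tendsto G atTop atTop := prod_tendsto θ d hθ1 hd
  have hG0 : ∀ m, 0 < G m := by
    intro m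
    refine Finset.prod_pos fun j _ => ?_
    have : (0:ℝ) ≤ j := by positivity
    have : 0 < (j:ℝ) + 1 + θ := by linarith
    positivity
  let F' : Filtration ℕ mΩ := ⟨fun m => F (m+1), fun i j hij => F.mono (by omega), fun i => F.le _⟩
  set f : ℕ → Ω → ℝ := fun m => G m • W (m+1) with hf
  have hWn : ∀ n, 1 ≤ n → ∀ᵐ ω ∂μ, 0 ≤ W n ω := by
    intro n hn
    filter_upwards [ae_bounds hEP n hn] with ω h1
    exact hgn _ h1.1 _
  have hfi : ∀ m, Integrable (f m) μ := fun m => (fun_int hEP g (m+1) (by omega)).smul (G m)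
  have hsup : Supermartingale f F' μ := by
    refine supermartingale_nat ?_ hfi ?_
    · intro m
      exact (smeas_fun hEP g (m+1)).const_smul (G m)
    · intro m
      change μ[G (m+1) • W (m+1+1) | F (m+1)] ≤ᵐ[μ] f m
      filter_upwards [condExp_smul (μ := μ) (G (m+1)) (W (m+1+1)) (F (m+1)), hstep (m+1) (by omega),
        hWn (m+1) (by omega)] with ω h1 h2 h3
      rw [h1]
      simp only [Pi.smul_apply, smul_eq_mul, hf]
      have hGs : G (m+1) = G m * (1 + d / ((m:ℝ) + 1 + θ)) := by
        simp only [hG]; rw [Finset.prod_range_succ]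
      push_cast at h2
      set q := d / ((m:ℝ) + 1 + θ) with hq
      calc _ ≤ G (m+1) * ((1 - q) * W (m+1) ω) :=
            mul_le_mul_of_nonneg_left h2 (hG0 _).le
        _ = G m * W (m+1) ω - G m * W (m+1) ω * q^2 := by rw [hGs]; ring
        _ ≤ _ := by
          have := mul_nonneg (mul_nonneg (hG0 m).le h3) (sq_nonneg q)
          linarith
  have hbound : ∀ m, eLpNorm ((-f) m) 1 μ ≤ ((∫ ω, f 0 ω ∂μ).toNNReal : ENNReal) := by
    intro m
    rw [Pi.neg_apply, eLpNorm_neg, eLpNorm_one_eq_lintegral_enorm,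
      ← ofReal_integral_norm_eq_lintegral_enorm (hfi m)]
    refine ENNReal.ofReal_le_ofReal ?_
    have h1 := hsup.setIntegral_le (Nat.zero_le m) (s := Set.univ) MeasurableSet.univ
    rw [setIntegral_univ, setIntegral_univ] at h1
    refine le_trans (le_of_eq ?_) h1
    refine integral_congr_ae ?_
    filter_upwards [hWn (m+1) (by omega)] with ω h3
    exact Real.norm_of_nonneg (mul_nonneg (hG0 m).le h3)
  have hconv := hsup.neg.ae_tendsto_limitProcess hbound
  have hall : ∀ᵐ ω ∂μ, ∀ n, 1 ≤ n → 1 ≤ K n ω := by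
    rw [ae_all_iff]; intro n
    by_cases hn : 1 ≤ n
    · filter_upwards [ae_bounds hEP n hn] with ω h1 _ using h1.1
    · exact ae_of_all _ fun ω hh => absurd hh hn
  filter_upwards [hconv, hall] with ω hω hK
  have hWt : Tendsto (fun m => W (m+1) ω) atTop (𝓝 0) := by
    have h1 := (hω.neg).mul hGt.inv_tendsto_atTop
    rw [mul_zero] at h1
    refine h1.congr fun m => ?_
    have := (hG0 m).ne'
    simp [hf]
    field_simp
  have hWt' : Tendsto (fun m => W m ω) atTop (𝓝 0) := (tendsto_add_atTop_iff_nat 1).1 hWt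
  have hev : ∀ᶠ n in atTop, 0 < (K n ω : ℝ) + c := by
    filter_upwards [eventually_ge_atTop 1] with n hn
    exact hy0.trans_le (hYk _ (hK n hn))
  have hV : Tendsto (fun n => ((B 1 n ω : ℝ) / (K n ω + c) - α)^2) atTop (𝓝 0) := by
    refine squeeze_zero' (Eventually.of_forall fun n => sq_nonneg _) ?_ hWt'
    filter_upwards [hev] with n hn
    have : 0 ≤ A / ((K n ω : ℝ) + c) := by positivity
    simp only [hW, hg, wfun]
    linarith
  have hI : Tendsto (fun n => 1 / ((K n ω : ℝ) + c)) atTop (𝓝 0) := by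
    have h0 : Tendsto (fun n => W n ω / A) atTop (𝓝 0) := by simpa using hWt'.div_const A
    refine squeeze_zero' ?_ ?_ h0
    · filter_upwards [hev] with n hn
      positivity
    · filter_upwards [hev] with n hn
      rw [le_div_iff₀ hA]
      have := sq_nonneg ((B 1 n ω : ℝ) / (K n ω + c) - α)
      simp only [hW, hg, wfun]
      have e : 1 / ((K n ω : ℝ) + c) * A = A / ((K n ω : ℝ) + c) := by ring
      linarith
  have hR : Tendsto (fun n => (B 1 n ω : ℝ) / (K n ω + c)) atTop (𝓝 α) := by
    have h1 : Tendsto (fun n => |(B 1 n ω : ℝ) / (K n ω + c) - α|) atTop (𝓝 0) := by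
      have := hV.sqrt
      simpa [Real.sqrt_sq_eq_abs] using this
    have h2 := (tendsto_zero_iff_abs_tendsto_zero _).2 h1
    simpa using h2.add_const α
  have hD : Tendsto (fun n => 1 - c * (1 / ((K n ω : ℝ) + c))) atTop (𝓝 1) := by
    simpa using (hI.const_mul c).const_sub 1
  have hF := hR.div hD one_ne_zero
  rw [div_one] at hF
  refine hF.congr' ?_
  filter_upwards [hev, eventually_ge_atTop 1] with n hn hn1
  have hk : (1:ℝ) ≤ K n ω := by exact_mod_cast hK n hn1
  have hk0 : (K n ω : ℝ) ≠ 0 := by linarith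
  have e : 1 - c * (1 / ((K n ω : ℝ) + c)) = K n ω / (K n ω + c) := by
    field_simp; ring
  simp only [Pi.div_apply]
  rw [e]
  field_simp

end
end

section
/- Let α∈(0,1) and θ∈ℝ with α+θ>0, and let (K_n,(K_{r,n})_{r≥1}) be the Ewens–Pitman block-counting chain with parameters (α,θ). Then, with α̂_n = K_{1,n}/K_n, the random variable √(K_n)(α̂_n − α) converges in distribution, as n→∞, to a centered Gaussian distribution with variance α(1−α). -/
open MeasureTheory ProbabilityTheory Filter Topology

noncomputable section

lemma rec_aux (b : ℕ → ℝ) (c : ℝ) (hc : 0 < c) (hc1 : c ≤ 1) (m : ℕ) (hm : 1 ≤ m)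
    (h : ∀ n, m ≤ n → b (n+1) ≤ (1 - c / n) * b n) (j : ℕ) :
    b (m + j) ≤ |b m| * Real.exp (- c * ∑ i ∈ Finset.range j, 1 / ((i + m : ℕ) : ℝ)) := by
  induction j with
  | zero => simpa using le_abs_self (b m)
  | succ j ih =>
    have h1 := h (m + j) (by omega)
    have hpos : (1:ℝ) ≤ ((m + j : ℕ) : ℝ) := by exact_mod_cast (by omega : 1 ≤ m + j)
    have h2 : 0 ≤ 1 - c / ((m + j : ℕ) : ℝ) := by
      have : c / ((m + j : ℕ) : ℝ) ≤ 1 := by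
        rw [div_le_one (by linarith)]; linarith
      linarith
    have h3 : 1 - c / ((m + j : ℕ) : ℝ) ≤ Real.exp (-(c / ((m + j : ℕ) : ℝ))) := by
      have := Real.add_one_le_exp (-(c / ((m + j : ℕ) : ℝ)))
      linarith
    have hE : 0 ≤ |b m| * Real.exp (- c * ∑ i ∈ Finset.range j, 1 / ((i + m : ℕ) : ℝ)) := by
      positivity
    calc b (m + (j + 1)) ≤ (1 - c / ((m + j : ℕ) : ℝ)) * b (m + j) := h1
      _ ≤ (1 - c / ((m + j : ℕ) : ℝ)) *
          (|b m| * Real.exp (- c * ∑ i ∈ Finset.range j, 1 / ((i + m : ℕ) : ℝ))) :=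
          mul_le_mul_of_nonneg_left ih h2
      _ ≤ Real.exp (-(c / ((m + j : ℕ) : ℝ))) *
          (|b m| * Real.exp (- c * ∑ i ∈ Finset.range j, 1 / ((i + m : ℕ) : ℝ))) :=
          mul_le_mul_of_nonneg_right h3 hE
      _ = _ := by
        rw [Finset.sum_range_succ, mul_left_comm, ← Real.exp_add]
        congr 2
        rw [add_comm j m]
        ring

lemma rec_tendsto (a e : ℕ → ℝ) (c : ℝ) (hc : 0 < c) (hc1 : c ≤ 1) (ha : ∀ n, 0 ≤ a n)
    (h : ∀ n, 1 ≤ n → a (n+1) ≤ (1 - c / n) * a n + e n / n) (he : Tendsto e atTop (𝓝 0)) :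
    Tendsto a atTop (𝓝 0) := by
  rw [Metric.tendsto_atTop]
  intro ε hε
  have h1 : ∀ᶠ n in atTop, e n ≤ c * (ε / 2) :=
    (he.eventually_lt_const (by positivity : 0 < c * (ε / 2))).mono fun n hn => hn.le
  obtain ⟨m0, hm0⟩ := eventually_atTop.1 h1
  set m := max m0 1 with hm
  have hm1 : 1 ≤ m := le_max_right _ _
  have hrec : ∀ n, m ≤ n → (fun n => a n - ε / 2) (n+1) ≤ (1 - c / n) * (fun n => a n - ε / 2) n := by
    intro n hn
    have hn1 : 1 ≤ n := hm1.trans hn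
    have h2 := h n hn1
    have h3 := hm0 n ((le_max_left _ _).trans hn)
    have hpos : (0:ℝ) < n := by exact_mod_cast hn1
    have h4 : e n / n ≤ c * (ε / 2) / n := by gcongr
    simp only
    have h5 : (1 - c / n) * (a n - ε / 2) = (1 - c / n) * a n + c * (ε / 2) / n - ε / 2 := by
      field_simp
      ring
    linarith
  have haux := rec_aux (fun n => a n - ε / 2) c hc hc1 m hm1 hrec
  have hdiv : Tendsto (fun j => ∑ i ∈ Finset.range j, 1 / ((i + m : ℕ) : ℝ)) atTop atTop := by
    rw [← not_summable_iff_tendsto_nat_atTop_of_nonneg]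
    · exact mt (_root_.summable_nat_add_iff (f := fun i : ℕ => 1 / (i : ℝ)) m).1
        Real.not_summable_one_div_natCast
    · exact fun i => by positivity
  have hlim : Tendsto (fun j => |a m - ε / 2| *
      Real.exp (- c * ∑ i ∈ Finset.range j, 1 / ((i + m : ℕ) : ℝ))) atTop (𝓝 0) := by
    have h6 : Tendsto (fun j => - c * ∑ i ∈ Finset.range j, 1 / ((i + m : ℕ) : ℝ)) atTop atBot :=
      hdiv.const_mul_atTop_of_neg (by linarith)
    simpa using (Real.tendsto_exp_atBot.comp h6).const_mul (|a m - ε / 2|)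
  obtain ⟨j0, hj0⟩ := eventually_atTop.1
    (hlim.eventually_lt_const (by positivity : 0 < ε / 2))
  refine ⟨m + j0, fun n hn => ?_⟩
  obtain ⟨j, rfl⟩ := Nat.exists_eq_add_of_le hn
  have h7 := haux (j0 + j)
  have h8 := hj0 (j0 + j) (by omega)
  rw [← add_assoc] at h7
  rw [Real.dist_eq, sub_zero, abs_of_nonneg (ha _)]
  linarith

set_option maxHeartbeats 1000000 in
lemma step_real (α θ n r R z b p q d C E : ℝ) (hα0 : 0 < α) (hα1 : α < 1) (hθ : 0 < α + θ)
    (hn : 1 ≤ n) (hr : 1 ≤ r) (hrn : r ^ 2 ≤ n) (hR : 0 < R) (hRr : R ^ 2 = r ^ 2 + 1)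
    (hz : |z| ≤ r) (hb : b = α * r ^ 2 + z * r) (hb0 : 0 ≤ b) (hb1 : b ≤ r ^ 2)
    (hp : p = (α * r ^ 2 + θ) / (n + θ)) (hq : q = (1 - α) * b / (n + θ))
    (hd : d = (1 - α) / R - z / (R * (R + r))) (hC : C = |θ| / (1 - α))
    (hE : E = (1 + |z|) / (n * r)) :
    |d| ≤ 2 / r ∧ |p| ≤ (1 + C) * r ^ 2 / n ∧ |q| ≤ (1 + C) * r ^ 2 / n ∧
    |p * d - q / r + (1 - α / 2) * z / n| ≤ (1 + 2 * C) * E ∧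
    |p * d ^ 2 + q / r ^ 2 - 2 * (1 - α / 2) * (α * (1 - α)) / n| ≤ (10 + 10 * C) * E := by
  have hr0 : 0 < r := by linarith
  have hn0 : 0 < n := by linarith
  have ha : 0 < 1 - α := by linarith
  have hnθ : (1 - α) * n ≤ n + θ := by nlinarith
  have hnθ0 : 0 < n + θ := by nlinarith
  have hC0 : 0 ≤ C := by rw [hC]; positivity
  have hz0 := abs_nonneg z
  have hrR : r < R := lt_of_pow_lt_pow_left₀ 2 hR.le (by linarith)
  have hrR1 : r * r ≤ R * r := mul_le_mul_of_nonneg_right hrR.le hr0.le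
  have hrR2 : R * r ≤ R * R := mul_le_mul_of_nonneg_left hrR.le hR.le
  have hRe : R * (R + r) = r ^ 2 + 1 + R * r := by rw [mul_add, ← hRr]; ring
  have hrr : r ^ 2 = r * r := by ring
  have hRR2 : R * R = r ^ 2 + 1 := by rw [← hRr]; ring
  have hr2 : 1 ≤ r ^ 2 := one_le_pow₀ hr
  have hab : (1 - α) * b ≤ r ^ 2 :=
    (mul_le_of_le_one_left hb0 (by linarith)).trans hb1
  have har : α * r ^ 2 ≤ r ^ 2 := mul_le_of_le_one_left (by positivity) hα1.le
  -- error in p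
  have hθC : |θ| / (n + θ) ≤ C / n := by
    rw [hC, div_div]
    gcongr
  have ep : |p - α * r ^ 2 / n| ≤ C / n := by
    have e1 : p - α * r ^ 2 / n = θ / (n + θ) * ((n - α * r ^ 2) / n) := by
      rw [hp]; field_simp; ring
    rw [e1, abs_mul, abs_div, abs_of_pos hnθ0]
    have : |(n - α * r ^ 2) / n| ≤ 1 := by
      have h1 : α * r ^ 2 ≤ n := by linarith
      rw [abs_of_nonneg (div_nonneg (by linarith) hn0.le), div_le_one hn0]
      have : 0 ≤ α * r ^ 2 := by positivity
      linarith
    calc _ ≤ |θ| / (n + θ) * 1 := by gcongr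
      _ ≤ _ := by linarith
  have eq : |q - (1 - α) * b / n| ≤ C / n := by
    have e1 : q - (1 - α) * b / n = - (θ / (n + θ) * ((1 - α) * b / n)) := by
      rw [hq]; field_simp; ring
    rw [e1, abs_neg, abs_mul, abs_div, abs_of_pos hnθ0]
    have : |(1 - α) * b / n| ≤ 1 := by
      rw [abs_of_nonneg (by positivity), div_le_one hn0]
      linarith
    calc _ ≤ |θ| / (n + θ) * 1 := by gcongr
      _ ≤ _ := by linarith
  have hCr : C / n ≤ C * r ^ 2 / n := by
    gcongr; exact le_mul_of_one_le_right hC0 hr2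
  have hP : |p| ≤ (1 + C) * r ^ 2 / n := by
    have h1 : |p| ≤ |p - α * r ^ 2 / n| + |α * r ^ 2 / n| := by
      have := abs_add_le (p - α * r ^ 2 / n) (α * r ^ 2 / n); simpa using this
    have h2 : |α * r ^ 2 / n| ≤ r ^ 2 / n := by
      rw [abs_of_nonneg (by positivity)]; gcongr
    have : (1 + C) * r ^ 2 / n = r ^ 2 / n + C * r ^ 2 / n := by ring
    linarith
  have hQ : |q| ≤ (1 + C) * r ^ 2 / n := by
    have h1 : |q| ≤ |q - (1 - α) * b / n| + |(1 - α) * b / n| := by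
      have := abs_add_le (q - (1 - α) * b / n) ((1 - α) * b / n); simpa using this
    have h2 : |(1 - α) * b / n| ≤ r ^ 2 / n := by
      rw [abs_of_nonneg (by positivity)]; gcongr
    have : (1 + C) * r ^ 2 / n = r ^ 2 / n + C * r ^ 2 / n := by ring
    linarith
  -- d
  have hRinv : |1 / R - 1 / r| ≤ 1 / r ^ 3 := by
    have e1 : 1 / R - 1 / r = - (1 / (r * R * (R + r))) := by
      field_simp
      linear_combination -hRr
    rw [e1, abs_neg, abs_of_pos (by positivity)]
    apply one_div_le_one_div_of_le (by positivity)
    have : r * r ≤ R * (R + r) := by linarith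
    calc r ^ 3 = r * (r * r) := by ring
      _ ≤ r * (R * (R + r)) := mul_le_mul_of_nonneg_left this hr0.le
      _ = _ := by ring
  have hRR : |1 / (R * (R + r)) - 1 / (2 * r ^ 2)| ≤ 1 / r ^ 4 := by
    have e0 : R * (R + r) - 2 * r ^ 2 ≤ 2 := by linarith
    have e2 : 0 ≤ R * (R + r) - 2 * r ^ 2 := by linarith
    have e1 : 1 / (R * (R + r)) - 1 / (2 * r ^ 2)
        = - ((R * (R + r) - 2 * r ^ 2) / (R * (R + r) * (2 * r ^ 2))) := by
      field_simp
      ring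
    rw [e1, abs_neg, abs_of_nonneg (by positivity), div_le_div_iff₀ (by positivity) (by positivity)]
    have e3 : r ^ 2 ≤ R * (R + r) := by linarith
    calc (R * (R + r) - 2 * r ^ 2) * r ^ 4 ≤ 2 * r ^ 4 := by gcongr
      _ = r ^ 2 * (2 * r ^ 2) := by ring
      _ ≤ 1 * (R * (R + r) * (2 * r ^ 2)) := by rw [one_mul]; gcongr
  have hd1 : |d - ((1 - α) / r - z / (2 * r ^ 2))| ≤ (1 + |z|) / r ^ 3 := by
    have e1 : d - ((1 - α) / r - z / (2 * r ^ 2)) =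
      (1 - α) * (1 / R - 1 / r) - z * (1 / (R * (R + r)) - 1 / (2 * r ^ 2)) := by
      rw [hd]; ring
    rw [e1]
    refine (abs_sub _ _).trans ?_
    rw [abs_mul, abs_mul, abs_of_pos ha]
    have h1 : (1 - α) * |1 / R - 1 / r| ≤ 1 * (1 / r ^ 3) := by gcongr; linarith
    have h2 : |z| * |1 / (R * (R + r)) - 1 / (2 * r ^ 2)| ≤ |z| * (1 / r ^ 3) := by
      gcongr
      refine hRR.trans ?_
      apply one_div_le_one_div_of_le (by positivity)
      exact pow_le_pow_right₀ hr (by norm_num)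
    calc _ ≤ 1 * (1 / r ^ 3) + |z| * (1 / r ^ 3) := add_le_add h1 h2
      _ = _ := by ring
  have hRle : 1 / R ≤ 1 / r := one_div_le_one_div_of_le hr0 hrR.le
  have hRR' : 1 / (R * (R + r)) ≤ 1 / (r ^ 2) :=
    one_div_le_one_div_of_le (by positivity) (by linarith)
  have hdz : |d| ≤ 1 / r + |z| / r ^ 2 := by
    rw [hd]
    refine (abs_sub _ _).trans ?_
    rw [abs_div, abs_div, abs_of_pos ha, abs_of_pos hR, abs_of_pos (by positivity : 0 < R * (R + r))]
    have h1 : (1 - α) / R ≤ 1 / r := by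
      calc (1 - α) / R ≤ 1 / R := by gcongr; linarith
        _ ≤ _ := hRle
    have h2 : |z| / (R * (R + r)) ≤ |z| / r ^ 2 := by gcongr; linarith
    linarith
  have hzr : |z| / r ^ 2 ≤ 1 / r := by
    rw [div_le_div_iff₀ (by positivity) hr0, one_mul, hrr]
    exact mul_le_mul_of_nonneg_right hz hr0.le
  have hdr : |d| ≤ 2 / r := by
    have : 2 / r = 1 / r + 1 / r := by ring
    linarith
  have hdE : |d| ≤ (1 + |z|) / r := by
    have : (1 + |z|) / r = 1 / r + |z| / r := by ring
    have h2 : |z| / r ^ 2 ≤ |z| / r := by gcongr; exact le_self_pow₀ hr (by norm_num)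
    linarith
  have hEr : E = (1 + |z|) / r / n := by rw [hE]; field_simp
  have h1E : 1 / (n * r) ≤ E := by rw [hE]; gcongr; linarith
  have hzE : |z| / (n * r) ≤ E := by rw [hE]; gcongr; linarith
  have hE0 : 0 ≤ E := by rw [hE]; positivity
  refine ⟨hdr, hP, hQ, ?_, ?_⟩
  · have e1 : p * d - q / r + (1 - α / 2) * z / n =
      α * r ^ 2 / n * (d - ((1 - α) / r - z / (2 * r ^ 2))) + (p - α * r ^ 2 / n) * d
        - (q - (1 - α) * b / n) / r := by
      rw [hb]; field_simp; ring
    rw [e1]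
    refine (abs_sub _ _).trans ((add_le_add_left (abs_add_le _ _) _).trans ?_)
    rw [abs_mul, abs_mul, abs_div _ r, abs_of_pos hr0,
      abs_of_nonneg (by positivity : 0 ≤ α * r ^ 2 / n)]
    have h1 : α * r ^ 2 / n * |d - ((1 - α) / r - z / (2 * r ^ 2))| ≤ E := by
      calc _ ≤ 1 * r ^ 2 / n * ((1 + |z|) / r ^ 3) := by gcongr
        _ = E := by rw [hE]; field_simp
    have h2 : |p - α * r ^ 2 / n| * |d| ≤ C * E := by
      calc _ ≤ C / n * ((1 + |z|) / r) := by gcongr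
        _ = C * E := by rw [hE]; field_simp
    have h3 : |q - (1 - α) * b / n| / r ≤ C * E := by
      calc _ ≤ C / n / r := by gcongr
        _ = C * (1 / (n * r)) := by field_simp
        _ ≤ C * E := by gcongr
    linarith
  · have e1 : p * d ^ 2 + q / r ^ 2 - 2 * (1 - α / 2) * (α * (1 - α)) / n =
      p * ((d - (1 - α) / r) * (d + (1 - α) / r)) + (p - α * r ^ 2 / n) * ((1 - α) ^ 2 / r ^ 2)
        + (q - (1 - α) * b / n) / r ^ 2 + (1 - α) * (z / (n * r)) := by
      rw [hb]; field_simp; ring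
    have hd2 : |d - (1 - α) / r| ≤ 2 * (1 + |z|) / r ^ 2 := by
      have e2 : d - (1 - α) / r = (d - ((1 - α) / r - z / (2 * r ^ 2))) - z / (2 * r ^ 2) := by ring
      rw [e2]
      refine (abs_sub _ _).trans ?_
      rw [abs_div, abs_of_pos (by positivity : 0 < 2 * r ^ 2)]
      have h1 : (1 + |z|) / r ^ 3 ≤ (1 + |z|) / r ^ 2 := by
        gcongr 1
        exact pow_le_pow_right₀ hr (by norm_num)
      have h2 : |z| / (2 * r ^ 2) ≤ (1 + |z|) / r ^ 2 := by
        gcongr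
        · linarith
        · linarith
      have : 2 * (1 + |z|) / r ^ 2 = (1 + |z|) / r ^ 2 + (1 + |z|) / r ^ 2 := by ring
      linarith
    have hd3 : |d + (1 - α) / r| ≤ 3 / r := by
      refine (abs_add_le _ _).trans ?_
      have : |(1 - α) / r| ≤ 1 / r := by
        rw [abs_of_nonneg (by positivity)]; gcongr; linarith
      have : 3 / r = 2 / r + 1 / r := by ring
      linarith
    rw [e1]
    refine (abs_add_le _ _).trans ((add_le_add_left ((abs_add_le _ _).trans
      (add_le_add_left (abs_add_le _ _) _)) _).trans ?_)
    have h1 : |p * ((d - (1 - α) / r) * (d + (1 - α) / r))| ≤ 6 * (1 + C) * E := by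
      rw [abs_mul, abs_mul]
      calc _ ≤ (1 + C) * r ^ 2 / n * (2 * (1 + |z|) / r ^ 2 * (3 / r)) := by gcongr
        _ = 6 * (1 + C) * E := by rw [hE]; field_simp; ring
    have h2 : |(p - α * r ^ 2 / n) * ((1 - α) ^ 2 / r ^ 2)| ≤ C * E := by
      rw [abs_mul, abs_of_nonneg (by positivity : 0 ≤ (1 - α) ^ 2 / r ^ 2)]
      calc _ ≤ C / n * (1 / r) := by
            gcongr ?_ * ?_
            rw [div_le_div_iff₀ (by positivity) hr0]
            have e5 : (1 - α) ^ 2 ≤ 1 := pow_le_one₀ ha.le (by linarith)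
            have e6 : r ≤ r ^ 2 := le_self_pow₀ hr (by norm_num)
            exact mul_le_mul e5 e6 hr0.le zero_le_one
        _ = C * (1 / (n * r)) := by field_simp
        _ ≤ C * E := by gcongr
    have h3 : |(q - (1 - α) * b / n) / r ^ 2| ≤ C * E := by
      rw [abs_div, abs_of_pos (by positivity : 0 < r ^ 2)]
      calc _ ≤ C / n / r := by gcongr; exact le_self_pow₀ hr (by norm_num)
        _ = C * (1 / (n * r)) := by field_simp
        _ ≤ C * E := by gcongr
    have h4 : |(1 - α) * (z / (n * r))| ≤ E := by
      rw [abs_mul, abs_div, abs_of_pos ha, abs_of_pos (by positivity : 0 < n * r)]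
      exact (mul_le_of_le_one_left (by positivity) (by linarith)).trans hzE
    have h5 : 0 ≤ C * E := by positivity
    linarith

lemma exp_taylor2 (u : ℝ) :
    ‖Complex.exp (Complex.I * u) - (1 + Complex.I * u - (u:ℂ) ^ 2 / 2)‖ ≤ |u| ^ 3 * Real.exp |u| := by
  have h := Complex.norm_exp_sub_sum_le_norm_mul_exp (Complex.I * u) 3
  have e : ∑ m ∈ Finset.range 3, (Complex.I * u) ^ m / (m.factorial : ℂ)
      = 1 + Complex.I * u - (u:ℂ) ^ 2 / 2 := by
    simp [Finset.sum_range_succ, mul_pow]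
    ring
  rw [e] at h
  simpa using h

lemma exp_taylor1 (w : ℂ) :
    ‖Complex.exp (-w) - (1 - w)‖ ≤ ‖w‖ ^ 2 * Real.exp ‖w‖ := by
  have h := Complex.norm_exp_sub_sum_le_norm_mul_exp (-w) 2
  have e : ∑ m ∈ Finset.range 2, (-w) ^ m / (m.factorial : ℂ) = 1 - w := by
    simp [Finset.sum_range_succ]
    ring
  rw [e] at h
  simpa using h

/-- the constant -/
noncomputable def stepConst (C t : ℝ) : ℝ :=
  (1 + 2 * C) + t * (5 + 5 * C) + t + 8 * (1 + C) * t ^ 2 * Real.exp (2 * t)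
    + (1 + C) * t ^ 2 * Real.exp t + 2 * t * (1 + t) ^ 2 * Real.exp (2 * t * (1 + t))

set_option maxHeartbeats 1000000 in
lemma step_cx (α θ n r R z b p q d C E s t : ℝ) (hα0 : 0 < α) (hα1 : α < 1) (hθ : 0 < α + θ)
    (hn : 1 ≤ n) (hr : 1 ≤ r) (hrn : r ^ 2 ≤ n) (hR : 0 < R) (hRr : R ^ 2 = r ^ 2 + 1)
    (hz : |z| ≤ r) (hb : b = α * r ^ 2 + z * r) (hb0 : 0 ≤ b) (hb1 : b ≤ r ^ 2)
    (hp : p = (α * r ^ 2 + θ) / (n + θ)) (hq : q = (1 - α) * b / (n + θ))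
    (hd : d = (1 - α) / R - z / (R * (R + r))) (hC : C = |θ| / (1 - α))
    (hE : E = (1 + |z|) / (n * r)) (hs : |s| ≤ t) (w : ℂ)
    (hw : w = Complex.I * ((s * ((1 - α / 2) * z / n) : ℝ) : ℂ) +
      ((α * (1 - α) * (s ^ 2 - (s * (1 - (1 - α / 2) / n)) ^ 2) / 2 : ℝ) : ℂ)) :
    ‖(p:ℂ) * (Complex.exp (Complex.I * ((s * d : ℝ) : ℂ)) - 1)
      + (q:ℂ) * (Complex.exp (Complex.I * ((-(s / r) : ℝ) : ℂ)) - 1) + 1 - Complex.exp (-w)‖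
      ≤ stepConst C t * |s| * E := by
  obtain ⟨hd2, hP, hQ, h1, h2⟩ := step_real α θ n r R z b p q d C E hα0 hα1 hθ hn hr hrn hR hRr hz
    hb hb0 hb1 hp hq hd hC hE
  have ha : 0 < 1 - α := by linarith
  have hC0 : 0 ≤ C := by rw [hC]; positivity
  clear hp hq hd hb hb0 hb1 hRr hR hθ hC
  have hs0 := abs_nonneg s
  have ht0 : 0 ≤ t := hs0.trans hs
  have hr0 : 0 < r := by linarith
  have hn0 : 0 < n := by linarith
  have hz0 := abs_nonneg z
  have hE0 : 0 ≤ E := by rw [hE]; positivity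
  have h1E : 1 / (n * r) ≤ E := by rw [hE]; gcongr; linarith
  have hrn' : r ≤ n := (le_self_pow₀ hr (by norm_num)).trans hrn
  set β := 1 - α / 2 with hβ
  have hβ0 : 0 < β := by rw [hβ]; linarith
  have hβ1 : β ≤ 1 := by rw [hβ]; linarith
  have hσ0 : 0 < α * (1 - α) := by positivity
  have hσ1 : α * (1 - α) ≤ 1 := mul_le_one₀ hα1.le ha.le (by linarith)
  set σ := α * (1 - α) with hσ
  clear_value β σ
  set u := p * d - q / r + β * z / n with hu
  set v := p * d ^ 2 + q / r ^ 2 - 2 * β * σ / n with hv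
  set ρ1 := Complex.exp (Complex.I * ((s * d : ℝ) : ℂ)) -
    (1 + Complex.I * ((s * d : ℝ) : ℂ) - ((s * d : ℝ) : ℂ) ^ 2 / 2) with hρ1
  set ρ2 := Complex.exp (Complex.I * ((-(s / r) : ℝ) : ℂ)) -
    (1 + Complex.I * ((-(s / r) : ℝ) : ℂ) - ((-(s / r) : ℝ) : ℂ) ^ 2 / 2) with hρ2
  set ρ3 := Complex.exp (-w) - (1 - w) with hρ3
  have key : (p:ℂ) * (Complex.exp (Complex.I * ((s * d : ℝ) : ℂ)) - 1)
      + (q:ℂ) * (Complex.exp (Complex.I * ((-(s / r) : ℝ) : ℂ)) - 1) + 1 - Complex.exp (-w)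
      = Complex.I * ((s * u : ℝ) : ℂ) + ((- (s ^ 2 / 2 * v) : ℝ) : ℂ)
        + ((-(σ * s ^ 2 * β ^ 2 / (2 * n ^ 2)) : ℝ) : ℂ)
        + (p : ℂ) * ρ1 + (q : ℂ) * ρ2 - ρ3 := by
    rw [hρ1, hρ2, hρ3, hu, hv, hw]
    push_cast
    have hnc : (n : ℂ) ≠ 0 := by exact_mod_cast hn0.ne'
    have hrc : (r : ℂ) ≠ 0 := by exact_mod_cast hr0.ne'
    field_simp
    ring
  have b1 : ‖Complex.I * ((s * u : ℝ) : ℂ)‖ ≤ (1 + 2 * C) * |s| * E := by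
    rw [norm_mul, Complex.norm_I, one_mul, Complex.norm_real, Real.norm_eq_abs, abs_mul]
    calc |s| * |u| ≤ |s| * ((1 + 2 * C) * E) := by gcongr
      _ = _ := by ring
  have b2 : ‖((- (s ^ 2 / 2 * v) : ℝ) : ℂ)‖ ≤ t * (5 + 5 * C) * |s| * E := by
    rw [Complex.norm_real, Real.norm_eq_abs, abs_neg, abs_mul, abs_div, abs_pow, abs_two]
    calc |s| ^ 2 / 2 * |v| ≤ |s| ^ 2 / 2 * ((10 + 10 * C) * E) := by gcongr
      _ = |s| * (|s| * (5 + 5 * C) * E) := by ring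
      _ ≤ |s| * (t * (5 + 5 * C) * E) := by gcongr
      _ = _ := by ring
  have b3 : ‖((-(σ * s ^ 2 * β ^ 2 / (2 * n ^ 2)) : ℝ) : ℂ)‖ ≤ t * |s| * E := by
    rw [Complex.norm_real, Real.norm_eq_abs, abs_neg, abs_of_nonneg (by positivity), ← sq_abs s]
    calc σ * |s| ^ 2 * β ^ 2 / (2 * n ^ 2) ≤ 1 * |s| ^ 2 * 1 ^ 2 / (1 * (n * r)) := by
          gcongr
          · norm_num
          · rw [pow_two]; gcongr
      _ = |s| * |s| * (1 / (n * r)) := by field_simp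
      _ ≤ t * |s| * E := by gcongr
  have b4 : ‖(p : ℂ) * ρ1‖ ≤ 8 * (1 + C) * t ^ 2 * Real.exp (2 * t) * |s| * E := by
    have hsd : |s * d| ≤ 2 * |s| / r := by
      rw [abs_mul]
      calc |s| * |d| ≤ |s| * (2 / r) := by gcongr
        _ = _ := by ring
    have hsd' : |s * d| ≤ 2 * t := by
      refine hsd.trans ?_
      rw [div_le_iff₀ hr0]
      calc 2 * |s| ≤ 2 * t := by gcongr
        _ ≤ 2 * t * r := le_mul_of_one_le_right (by positivity) hr
    rw [norm_mul, Complex.norm_real, Real.norm_eq_abs]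
    calc |p| * ‖ρ1‖ ≤ (1 + C) * r ^ 2 / n * (|s * d| ^ 3 * Real.exp |s * d|) := by
          gcongr; exact exp_taylor2 _
      _ ≤ (1 + C) * r ^ 2 / n * ((2 * |s| / r) ^ 3 * Real.exp (2 * t)) := by gcongr
      _ = 8 * (1 + C) * |s| ^ 2 * Real.exp (2 * t) * |s| * (1 / (n * r)) := by field_simp; ring
      _ ≤ _ := by gcongr
  have b5 : ‖(q : ℂ) * ρ2‖ ≤ (1 + C) * t ^ 2 * Real.exp t * |s| * E := by
    have hsd : |-(s / r)| = |s| / r := by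
      rw [abs_neg, abs_div, abs_of_pos hr0]
    have hsd' : |s| / r ≤ t := by
      rw [div_le_iff₀ hr0]
      exact hs.trans (le_mul_of_one_le_right (by positivity) hr)
    rw [norm_mul, Complex.norm_real, Real.norm_eq_abs]
    have h5 := exp_taylor2 (-(s / r))
    rw [hsd] at h5
    calc |q| * ‖ρ2‖ ≤ (1 + C) * r ^ 2 / n * ((|s| / r) ^ 3 * Real.exp (|s| / r)) := by
          gcongr
      _ ≤ (1 + C) * r ^ 2 / n * ((|s| / r) ^ 3 * Real.exp t) := by gcongr
      _ = (1 + C) * |s| ^ 2 * Real.exp t * |s| * (1 / (n * r)) := by field_simp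
      _ ≤ _ := by gcongr
  have hwn : ‖w‖ ≤ |s| * (1 + t) * ((1 + |z|) / n) := by
    rw [hw]
    refine (norm_add_le _ _).trans ?_
    rw [norm_mul, Complex.norm_I, one_mul, Complex.norm_real, Real.norm_eq_abs, Complex.norm_real,
      Real.norm_eq_abs]
    have e1 : |s * (β * z / n)| ≤ |s| * (|z| / n) := by
      rw [abs_mul, abs_div, abs_mul, abs_of_pos hn0, abs_of_pos hβ0]
      gcongr
      exact mul_le_of_le_one_left hz0 hβ1
    have e2 : |σ * (s ^ 2 - (s * (1 - β / n)) ^ 2) / 2| ≤ |s| * t * (1 / n) := by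
      have hbn : β / n ≤ 1 := (div_le_one hn0).2 (hβ1.trans hn)
      have hbn0 : 0 ≤ β / n := by positivity
      have e3 : σ * (s ^ 2 - (s * (1 - β / n)) ^ 2) / 2
          = σ * s ^ 2 * (β / n) * (1 - β / n / 2) := by ring
      rw [e3, abs_of_nonneg (mul_nonneg (by positivity) (by linarith)), ← sq_abs s]
      have e4 : β / n ≤ 1 / n := by gcongr
      calc σ * |s| ^ 2 * (β / n) * (1 - β / n / 2) ≤ 1 * |s| ^ 2 * (1 / n) * 1 := by
            gcongr <;> linarith
        _ = |s| * |s| * (1 / n) := by ring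
        _ ≤ |s| * t * (1 / n) := by gcongr
    have e5 : |s| * (1 + t) * ((1 + |z|) / n) = |s| * (|z| / n) + |s| * t * (1 / n)
      + (|s| * (1 / n) + |s| * t * (|z| / n)) := by ring
    have e6 : 0 ≤ |s| * (1 / n) + |s| * t * (|z| / n) := by positivity
    linarith
  have hzn : (1 + |z|) / n ≤ 2 := by
    rw [div_le_iff₀ hn0]; linarith
  have hwn' : ‖w‖ ≤ 2 * t * (1 + t) := by
    calc ‖w‖ ≤ |s| * (1 + t) * ((1 + |z|) / n) := hwn
      _ ≤ t * (1 + t) * 2 := by gcongr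
      _ = _ := by ring
  have hzE : ((1 + |z|) / n) ^ 2 ≤ 2 * E := by
    have e1 : ((1 + |z|) / n) ^ 2 = ((1 + |z|) * r / n) * E := by rw [hE]; field_simp
    rw [e1]
    gcongr
    rw [div_le_iff₀ hn0]
    calc (1 + |z|) * r ≤ (r + r) * r := by gcongr
      _ = 2 * r ^ 2 := by ring
      _ ≤ 2 * n := by gcongr
  have b6 : ‖ρ3‖ ≤ 2 * t * (1 + t) ^ 2 * Real.exp (2 * t * (1 + t)) * |s| * E := by
    calc ‖ρ3‖ ≤ ‖w‖ ^ 2 * Real.exp ‖w‖ := exp_taylor1 w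
      _ ≤ (|s| * (1 + t) * ((1 + |z|) / n)) ^ 2 * Real.exp (2 * t * (1 + t)) := by gcongr
      _ = |s| * |s| * (1 + t) ^ 2 * ((1 + |z|) / n) ^ 2 * Real.exp (2 * t * (1 + t)) := by ring
      _ ≤ |s| * t * (1 + t) ^ 2 * (2 * E) * Real.exp (2 * t * (1 + t)) := by gcongr
      _ = _ := by ring
  rw [key]
  have T := norm_sub_le (Complex.I * ((s * u : ℝ) : ℂ) + ((- (s ^ 2 / 2 * v) : ℝ) : ℂ)
        + ((-(σ * s ^ 2 * β ^ 2 / (2 * n ^ 2)) : ℝ) : ℂ)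
        + (p : ℂ) * ρ1 + (q : ℂ) * ρ2) ρ3
  have T1 := norm_add_le (Complex.I * ((s * u : ℝ) : ℂ) + ((- (s ^ 2 / 2 * v) : ℝ) : ℂ)
        + ((-(σ * s ^ 2 * β ^ 2 / (2 * n ^ 2)) : ℝ) : ℂ)
        + (p : ℂ) * ρ1) ((q : ℂ) * ρ2)
  have T2 := norm_add_le (Complex.I * ((s * u : ℝ) : ℂ) + ((- (s ^ 2 / 2 * v) : ℝ) : ℂ)
        + ((-(σ * s ^ 2 * β ^ 2 / (2 * n ^ 2)) : ℝ) : ℂ)) ((p : ℂ) * ρ1)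
  have T3 := norm_add_le (Complex.I * ((s * u : ℝ) : ℂ) + ((- (s ^ 2 / 2 * v) : ℝ) : ℂ))
        ((-(σ * s ^ 2 * β ^ 2 / (2 * n ^ 2)) : ℝ) : ℂ)
  have T4 := norm_add_le (Complex.I * ((s * u : ℝ) : ℂ)) ((- (s ^ 2 / 2 * v) : ℝ) : ℂ)
  have e : stepConst C t * |s| * E = (1 + 2 * C) * |s| * E + t * (5 + 5 * C) * |s| * E
    + t * |s| * E + 8 * (1 + C) * t ^ 2 * Real.exp (2 * t) * |s| * E
    + (1 + C) * t ^ 2 * Real.exp t * |s| * E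
    + 2 * t * (1 + t) ^ 2 * Real.exp (2 * t * (1 + t)) * |s| * E := by
    rw [stepConst]; ring
  rw [e]
  linarith

noncomputable def zf (α : ℝ) (k b : ℕ) : ℝ := Real.sqrt (k : ℝ) * ((b : ℝ) / (k : ℝ) - α)

noncomputable def pr (α θ : ℝ) (n k : ℕ) : ℝ := (α * (k : ℝ) + θ) / ((n : ℝ) + θ)

noncomputable def qr (α θ : ℝ) (n b : ℕ) : ℝ := ((1 - α) * (b : ℝ)) / ((n : ℝ) + θ)

noncomputable def hh (α s : ℝ) (k b : ℕ) : ℂ :=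
  Complex.exp (Complex.I * ((s * zf α k b : ℝ) : ℂ) + ((α * (1 - α) * s ^ 2 / 2 : ℝ) : ℂ))

lemma zf_eq (α : ℝ) (k b : ℕ) (hk : 1 ≤ k) :
    zf α k b = ((b : ℝ) - α * k) / Real.sqrt k := by
  have hk0 : (0:ℝ) < k := by exact_mod_cast hk
  have h := Real.mul_self_sqrt hk0.le
  have h0 : 0 < Real.sqrt k := Real.sqrt_pos.2 hk0
  rw [zf]
  set r := Real.sqrt (k:ℝ)
  rw [← h]
  field_simp

lemma zf_sq (α : ℝ) (k b : ℕ) (hk : 1 ≤ k) :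
    zf α k b ^ 2 = ((b : ℝ) - α * k) ^ 2 / k := by
  rw [zf_eq α k b hk, div_pow, Real.sq_sqrt (by positivity)]

lemma step_final (α θ s t : ℝ) (hα0 : 0 < α) (hα1 : α < 1) (hθ : 0 < α + θ) (hs : |s| ≤ t)
    (n k b : ℕ) (hk : 1 ≤ k) (hkn : k ≤ n) (hbk : b ≤ k) :
    ‖(pr α θ n k : ℂ) * hh α s (k+1) (b+1) + (qr α θ n b : ℂ) * hh α s k (b-1)
      + (1 - pr α θ n k - qr α θ n b : ℂ) * hh α s k b - hh α (s * (1 - (1 - α / 2) / n)) k b‖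
      ≤ Real.exp (t ^ 2) * stepConst (|θ| / (1 - α)) t * |s| *
        ((1 + |zf α k b|) / (n * Real.sqrt k)) := by
  have hk0 : (1:ℝ) ≤ k := by exact_mod_cast hk
  have hkn' : (k:ℝ) ≤ n := by exact_mod_cast hkn
  have hbk' : (b:ℝ) ≤ k := by exact_mod_cast hbk
  have hn1 : (1:ℝ) ≤ n := hk0.trans hkn'
  have hb0 : (0:ℝ) ≤ b := by positivity
  have ha : 0 < 1 - α := by linarith
  have hz := zf_eq α k b hk
  have hz1 := zf_eq α (k+1) (b+1) (by omega)
  set z := zf α k b with hzdef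
  set r := Real.sqrt (k:ℝ) with hrdef
  set R := Real.sqrt ((k+1 : ℕ):ℝ) with hRdef
  have hr2 : r ^ 2 = k := Real.sq_sqrt (by positivity)
  have hR2 : R ^ 2 = r ^ 2 + 1 := by
    rw [hr2, hRdef, Real.sq_sqrt (by positivity)]; push_cast; ring
  have hr1 : 1 ≤ r := Real.one_le_sqrt.2 hk0
  have hR0 : 0 < R := Real.sqrt_pos.2 (by positivity)
  have hr0 : 0 < r := by linarith
  have hb : (b:ℝ) = α * r ^ 2 + z * r := by
    rw [hz, hr2]; field_simp; ring
  have hzr : |z| ≤ r := by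
    rw [hz, abs_div, abs_of_pos hr0, div_le_iff₀ hr0, ← pow_two, hr2, abs_le]
    constructor <;> nlinarith
  set d := (1 - α) / R - z / (R * (R + r)) with hd
  have hzd : zf α (k+1) (b+1) = z + d := by
    rw [hz1, hd]
    push_cast
    have e1 : (b:ℝ) + 1 - α * (k + 1) = z * r + (1 - α) := by
      rw [← hr2, hb]; ring
    rw [e1]
    field_simp
    linear_combination -z * hR2
  have hmain := step_cx α θ n r R z b (pr α θ n k) (qr α θ n b) d (|θ| / (1 - α))
    ((1 + |z|) / (n * r)) s t hα0 hα1 hθ hn1 hr1 (by rw [hr2]; exact hkn') hR0 hR2 hzr hb hb0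
    (by rw [hr2]; exact hbk') (by rw [hr2]; rfl) rfl rfl rfl rfl hs _ rfl
  set w : ℂ := Complex.I * ((s * ((1 - α / 2) * z / n) : ℝ) : ℂ) +
      ((α * (1 - α) * (s ^ 2 - (s * (1 - (1 - α / 2) / n)) ^ 2) / 2 : ℝ) : ℂ) with hw
  have f1 : hh α s (k+1) (b+1) = hh α s k b * Complex.exp (Complex.I * ((s * d : ℝ) : ℂ)) := by
    rw [hh, hh, ← Complex.exp_add, hzd]
    congr 1
    push_cast
    ring
  have f2 : (qr α θ n b : ℂ) * hh α s k (b-1) =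
      (qr α θ n b : ℂ) * (hh α s k b * Complex.exp (Complex.I * ((-(s / r) : ℝ) : ℂ))) := by
    rcases Nat.eq_zero_or_pos b with h0 | h0
    · simp [qr, h0]
    · congr 1
      have : zf α k (b-1) = z - 1 / r := by
        rw [zf_eq α k (b-1) hk, hz, Nat.cast_sub h0]
        push_cast
        field_simp
        ring
      rw [hh, hh, ← Complex.exp_add, this]
      congr 1
      push_cast
      ring
  have f3 : hh α (s * (1 - (1 - α / 2) / n)) k b = hh α s k b * Complex.exp (-w) := by
    rw [hh, hh, ← Complex.exp_add, hw]
    congr 1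
    push_cast
    ring
  have f4 : (pr α θ n k : ℂ) * hh α s (k+1) (b+1) + (qr α θ n b : ℂ) * hh α s k (b-1)
      + (1 - pr α θ n k - qr α θ n b : ℂ) * hh α s k b - hh α (s * (1 - (1 - α / 2) / n)) k b
      = hh α s k b * ((pr α θ n k : ℂ) * (Complex.exp (Complex.I * ((s * d : ℝ) : ℂ)) - 1)
      + (qr α θ n b : ℂ) * (Complex.exp (Complex.I * ((-(s / r) : ℝ) : ℂ)) - 1) + 1
        - Complex.exp (-w)) := by
    rw [f2, f1, f3]; ring
  have f5 : ‖hh α s k b‖ ≤ Real.exp (t ^ 2) := by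
    rw [hh, Complex.norm_exp]
    apply Real.exp_le_exp.2
    simp only [Complex.add_re, Complex.mul_re, Complex.I_re, Complex.I_im, Complex.ofReal_re,
      Complex.ofReal_im, zero_mul, mul_zero, sub_zero, zero_add]
    have e1 : s ^ 2 ≤ t ^ 2 := by rw [← sq_abs s]; gcongr
    have e2 : α * (1 - α) ≤ 1 := mul_le_one₀ hα1.le ha.le (by linarith)
    have e3 : α * (1 - α) * s ^ 2 ≤ s ^ 2 := mul_le_of_le_one_left (sq_nonneg s) e2
    nlinarith [sq_nonneg s]
  rw [f4, norm_mul]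
  calc _ ≤ Real.exp (t ^ 2) * (stepConst (|θ| / (1 - α)) t * |s| * ((1 + |z|) / (n * r))) := by
        gcongr
    _ = _ := by ring

lemma lyap1 (α θ : ℝ) (hα0 : 0 < α) (hα1 : α < 1) (hθ : 0 < α + θ) :
    ∃ c : ℝ, 0 < c ∧ c ≤ 1 ∧ ∀ n k b : ℕ, 1 ≤ k → k ≤ n →
    pr α θ n k * (1 / ((k+1 : ℕ) : ℝ)) + qr α θ n b * (1 / (k : ℝ))
      + (1 - pr α θ n k - qr α θ n b) * (1 / (k : ℝ)) ≤ (1 - c / n) * (1 / (k : ℝ)) := by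
  obtain ⟨c0, hc0, hc1, hc2⟩ : ∃ c0 : ℝ, 0 < c0 ∧ c0 ≤ 1 ∧ ∀ k : ℝ, 1 ≤ k → c0 * k ≤ α * k + θ := by
    refine ⟨min α (α + θ), lt_min hα0 hθ, (min_le_left _ _).trans hα1.le, fun k hk => ?_⟩
    rcases le_total 0 θ with h | h
    · have := min_le_left α (α + θ)
      nlinarith
    · have := min_le_right α (α + θ)
      nlinarith
  refine ⟨c0 / (2 * (1 + |θ|)), by positivity, ?_, fun n k b hk hkn => ?_⟩
  · rw [div_le_one (by positivity)]
    have := abs_nonneg θ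
    linarith
  have hk0 : (1:ℝ) ≤ k := by exact_mod_cast hk
  have hkn' : (k:ℝ) ≤ n := by exact_mod_cast hkn
  have hn1 : (1:ℝ) ≤ n := hk0.trans hkn'
  have hnθ0 : 0 < (n:ℝ) + θ := by linarith
  have hk' : (0:ℝ) < k := by linarith
  have hn' : (0:ℝ) < n := by linarith
  have hp : c0 / (2 * (1 + |θ|)) / n ≤ pr α θ n k / (k + 1) := by
    rw [pr, div_div, div_div]
    rw [div_le_div_iff₀ (by positivity) (by positivity)]
    have h1 := hc2 k hk0
    have h2 : (n:ℝ) + θ ≤ (1 + |θ|) * n := by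
      have := le_abs_self θ
      have := abs_nonneg θ
      nlinarith
    calc c0 * ((n + θ) * (k + 1)) ≤ c0 * (((1 + |θ|) * n) * (k + k)) := by gcongr
      _ = c0 * k * (2 * (1 + |θ|) * n) := by ring
      _ ≤ _ := by gcongr
  have e1 : pr α θ n k * (1 / ((k+1 : ℕ) : ℝ)) + qr α θ n b * (1 / (k : ℝ))
      + (1 - pr α θ n k - qr α θ n b) * (1 / (k : ℝ)) = (1 - pr α θ n k / (k + 1)) * (1 / (k : ℝ)) := by
    push_cast
    field_simp
    ring
  rw [e1]
  gcongr

set_option maxHeartbeats 2000000 in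
lemma lyap2 (α θ : ℝ) (hα0 : 0 < α) (hα1 : α < 1) (hθ : 0 < α + θ) (n k b : ℕ)
    (hk : 1 ≤ k) (hkn : k ≤ n) (hbk : b ≤ k) :
    pr α θ n k * zf α (k+1) (b+1) ^ 2 + qr α θ n b * zf α k (b-1) ^ 2
      + (1 - pr α θ n k - qr α θ n b) * zf α k b ^ 2 ≤
      zf α k b ^ 2 + ((6 + 3 * |θ|) - (1 - α) * zf α k b ^ 2) / (n + θ) := by
  have hk0 : (1:ℝ) ≤ k := by exact_mod_cast hk
  have hkn' : (k:ℝ) ≤ n := by exact_mod_cast hkn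
  have hbk' : (b:ℝ) ≤ k := by exact_mod_cast hbk
  have hn1 : (1:ℝ) ≤ n := hk0.trans hkn'
  have hb0 : (0:ℝ) ≤ b := by positivity
  have ha : 0 < 1 - α := by linarith
  have hnθ0 : 0 < (n:ℝ) + θ := by linarith
  have hk' : (0:ℝ) < k := by linarith
  have f2 : qr α θ n b * zf α k (b-1) ^ 2 = qr α θ n b * (((b : ℝ) - α * k - 1) ^ 2 / k) := by
    rcases Nat.eq_zero_or_pos b with h0 | h0
    · simp [qr, h0]
    · rw [zf_sq α k (b-1) hk, Nat.cast_sub h0]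
      push_cast
      ring
  rw [f2, zf_sq α k b hk, zf_sq α (k+1) (b+1) (by omega)]
  obtain ⟨x, hx⟩ : ∃ x : ℝ, x = (b:ℝ) - α * k := ⟨_, rfl⟩
  have hxk : |x| ≤ k := by
    rw [hx, abs_le]
    constructor <;> nlinarith
  have e1 : ((b + 1 : ℕ) : ℝ) - α * ((k + 1 : ℕ) : ℝ) = x + (1 - α) := by
    rw [hx]; push_cast; ring
  have hbx : (b:ℝ) = x + α * k := by rw [hx]; ring
  rw [e1, ← hx, qr, pr, hbx]
  push_cast
  have hy := abs_le.1 hxk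
  -- y = x / k, y' = x/(k+1)
  obtain ⟨y, hy1⟩ : ∃ y : ℝ, y = x / (k + 1) := ⟨_, rfl⟩
  have hyb : |y| ≤ 1 := by
    rw [hy1, abs_div, abs_of_pos (by positivity : (0:ℝ) < k + 1), div_le_one (by positivity)]
    linarith
  have hyk : |x / k| ≤ 1 := by
    rw [abs_div, abs_of_pos hk', div_le_one hk']; exact hxk
  have key : (α * k + θ) * ((x + (1 - α)) ^ 2 / (k + 1) - x ^ 2 / k)
      + (1 - α) * (x + α * k) * ((x - 1) ^ 2 / k - x ^ 2 / k)
      = -(2 * (1 - α) * α * y) + θ * (2 * (1 - α) * y + (1 - α) ^ 2 * (1 / (k + 1)))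
        + α * (1 - α) ^ 2 * (k / (k + 1)) + (1 - α) * (x / k) + (1 - α) * α
        - 2 * (1 - α) * (x ^ 2 / k) - (α * k + θ) * (x ^ 2 / (k * (k + 1))) := by
    rw [hy1]
    field_simp
    ring
  have b1 : |2 * (1 - α) * α * y| ≤ 2 := by
    rw [abs_mul, abs_of_pos (by positivity : 0 < 2 * (1 - α) * α)]
    have : (1 - α) * α ≤ 1 := mul_le_one₀ (by linarith) hα0.le hα1.le
    nlinarith [abs_nonneg y]
  have hk1 : 1 / ((k:ℝ) + 1) ≤ 1 := by rw [div_le_one (by positivity)]; linarith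
  have hk1' : 0 < 1 / ((k:ℝ) + 1) := by positivity
  have ha2 : (1 - α) ^ 2 ≤ 1 := pow_le_one₀ ha.le (by linarith)
  have b2 : |θ * (2 * (1 - α) * y + (1 - α) ^ 2 * (1 / (k + 1)))| ≤ 3 * |θ| := by
    rw [abs_mul, mul_comm]
    gcongr
    refine (abs_add_le _ _).trans ?_
    rw [abs_mul, abs_of_pos (by positivity : 0 < 2 * (1 - α)),
      abs_of_pos (by positivity : 0 < (1 - α) ^ 2 * (1 / ((k:ℝ) + 1)))]
    have h1 : 2 * (1 - α) * |y| ≤ 2 * 1 * 1 := by gcongr; linarith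
    have h2 : (1 - α) ^ 2 * (1 / ((k:ℝ) + 1)) ≤ 1 * 1 := by gcongr
    linarith
  have b3 : α * (1 - α) ^ 2 * ((k:ℝ) / (k + 1)) ≤ 1 := by
    have : (k:ℝ) / (k + 1) ≤ 1 := by rw [div_le_one (by positivity)]; linarith
    calc _ ≤ 1 * 1 * (1:ℝ) := by gcongr
      _ = 1 := by norm_num
  have b4 : (1 - α) * (x / k) ≤ 1 := by
    have := (abs_le.1 hyk).2
    calc (1 - α) * (x / k) ≤ (1 - α) * 1 := mul_le_mul_of_nonneg_left this ha.le
      _ ≤ 1 := by linarith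
  have b5 : (1 - α) * α ≤ 1 := mul_le_one₀ (by linarith) hα0.le hα1.le
  have b6 : 0 ≤ (α * k + θ) * (x ^ 2 / (k * (k + 1))) := by
    apply mul_nonneg
    · have : α * 1 ≤ α * k := mul_le_mul_of_nonneg_left (by linarith) hα0.le
      linarith
    · positivity
  have b7 : 0 ≤ (1 - α) * (x ^ 2 / k) := by positivity
  have b1' := neg_abs_le (2 * (1 - α) * α * y)
  have b2' := le_abs_self (θ * (2 * (1 - α) * y + (1 - α) ^ 2 * (1 / (k + 1))))
  have fin : (α * k + θ) * ((x + (1 - α)) ^ 2 / (k + 1) - x ^ 2 / k)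
      + (1 - α) * (x + α * k) * ((x - 1) ^ 2 / k - x ^ 2 / k)
      ≤ (6 + 3 * |θ|) - (1 - α) * (x ^ 2 / k) := by
    rw [key]; linarith
  have e9 : (α * k + θ) / (n + θ) * ((x + (1 - α)) ^ 2 / (k + 1)) +
      (1 - α) * (x + α * k) / (n + θ) * ((x - 1) ^ 2 / k) +
      (1 - (α * k + θ) / (n + θ) - (1 - α) * (x + α * k) / (n + θ)) * (x ^ 2 / k)
      = x ^ 2 / k + ((α * k + θ) * ((x + (1 - α)) ^ 2 / (k + 1) - x ^ 2 / k)
      + (1 - α) * (x + α * k) * ((x - 1) ^ 2 / k - x ^ 2 / k)) / (n + θ) := by ring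
  rw [e9]
  gcongr

section EP
variable {α θ : ℝ} {Ω : Type*} {mΩ : MeasurableSpace Ω}
    {μ : Measure Ω} {F : Filtration ℕ mΩ} {K : ℕ → Ω → ℕ} {B : ℕ → ℕ → Ω → ℕ}

lemma EP_bounds (hEP : IsEwensPitman α θ μ F K B) (n : ℕ) (hn : 1 ≤ n) :
    ∀ᵐ ω ∂μ, 1 ≤ K n ω ∧ K n ω ≤ n ∧ B 1 n ω ≤ K n ω := by
  filter_upwards [hEP.sum_blocks n hn, hEP.sum_sizes n hn] with ω h1 h2
  refine ⟨?_, ?_, ?_⟩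
  · by_contra h
    have h0 : K n ω = 0 := by omega
    rw [h0] at h1
    have h3 := Finset.sum_eq_zero_iff.1 h1.symm
    have : n = 0 := by
      rw [h2]
      exact Finset.sum_eq_zero fun r hr => by rw [h3 r hr, mul_zero]
    omega
  · calc K n ω = ∑ r ∈ Finset.Icc 1 n, B r n ω := h1
      _ ≤ ∑ r ∈ Finset.Icc 1 n, r * B r n ω :=
        Finset.sum_le_sum fun r hr => Nat.le_mul_of_pos_left _ (Finset.mem_Icc.1 hr).1
      _ = n := h2.symm
  · rw [h1]
    exact Finset.single_le_sum (f := fun r => B r n ω) (fun _ _ => Nat.zero_le _)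
      (Finset.mem_Icc.2 ⟨le_refl 1, hn⟩)

variable {E : Type*} [NormedAddCommGroup E] [NormedSpace ℝ E]

lemma EP_sm (hEP : IsEwensPitman α θ μ F K B) (n : ℕ) (g : ℕ → ℕ → E) :
    StronglyMeasurable[F n] (fun ω => g (K n ω) (B 1 n ω)) := by
  have h1 : StronglyMeasurable (fun x : ℕ × ℕ => g x.1 x.2) := StronglyMeasurable.of_discrete
  have h2 : Measurable[F n] (fun ω => (K n ω, B 1 n ω)) := (hEP.meas_K n).prodMk (hEP.meas_B 1 n)
  exact h1.comp_measurable h2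

lemma EP_bound (hEP : IsEwensPitman α θ μ F K B) (n : ℕ) (hn : 1 ≤ n) (g : ℕ → ℕ → E) :
    ∃ C : ℝ, ∀ᵐ ω ∂μ, ‖g (K n ω) (B 1 n ω)‖ ≤ C := by
  refine ⟨∑ x ∈ Finset.range (n+1) ×ˢ Finset.range (n+1), ‖g x.1 x.2‖, ?_⟩
  filter_upwards [EP_bounds hEP n hn] with ω h
  exact Finset.single_le_sum (f := fun x : ℕ × ℕ => ‖g x.1 x.2‖) (fun _ _ => norm_nonneg _)
      (a := (K n ω, B 1 n ω)) (by simp; omega)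

lemma EP_int (hEP : IsEwensPitman α θ μ F K B) (n : ℕ) (hn : 1 ≤ n) (g : ℕ → ℕ → E) :
    Integrable (fun ω => g (K n ω) (B 1 n ω)) μ := by
  have := hEP.prob
  obtain ⟨C, hC⟩ := EP_bound hEP n hn g
  exact Integrable.of_bound ((EP_sm hEP n g).mono (F.le n)).aestronglyMeasurable C hC

lemma EP_pull [CompleteSpace E] (hEP : IsEwensPitman α θ μ F K B) (n : ℕ) (hn : 1 ≤ n)
    (g : ℕ → ℕ → E) (A : Set Ω) (hA : MeasurableSet A) (P : Ω → ℝ)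
    (hP : μ[Set.indicator A (fun _ => (1:ℝ)) | F n] =ᵐ[μ] P) :
    Integrable (fun ω => Set.indicator A (fun _ => (1:ℝ)) ω • g (K n ω) (B 1 n ω)) μ ∧
    ∫ ω, Set.indicator A (fun _ => (1:ℝ)) ω • g (K n ω) (B 1 n ω) ∂μ
      = ∫ ω, P ω • g (K n ω) (B 1 n ω) ∂μ := by
  have := hEP.prob
  have hint : Integrable (Set.indicator A (fun _ => (1:ℝ))) μ :=
    (integrable_const (1:ℝ)).indicator hA
  have hg := EP_int hEP n hn g
  have hi : Integrable (fun ω => Set.indicator A (fun _ => (1:ℝ)) ω • g (K n ω) (B 1 n ω)) μ := by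
    have e : (fun ω => Set.indicator A (fun _ => (1:ℝ)) ω • g (K n ω) (B 1 n ω))
        = Set.indicator A (fun ω => g (K n ω) (B 1 n ω)) := by
      ext ω
      by_cases h : ω ∈ A <;> simp [h]
    rw [e]
    exact hg.indicator hA
  refine ⟨hi, ?_⟩
  have h := condExp_bilin_of_stronglyMeasurable_left (m := F n) (μ := μ)
    (ContinuousLinearMap.lsmul ℝ ℝ : ℝ →L[ℝ] E →L[ℝ] E).flip (EP_sm hEP n g)
    (g := Set.indicator A (fun _ => (1:ℝ))) (by simpa using hi) hint
  have h2 := integral_condExp (μ := μ) (F.le n)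
    (f := fun ω => Set.indicator A (fun _ => (1:ℝ)) ω • g (K n ω) (B 1 n ω))
  rw [← h2]
  refine integral_congr_ae ?_
  simp only [ContinuousLinearMap.flip_apply, ContinuousLinearMap.lsmul_apply] at h
  filter_upwards [h, hP] with ω h3 h4
  rw [h3, h4]

/-- new block event -/
def evN (K : ℕ → Ω → ℕ) (B : ℕ → ℕ → Ω → ℕ) (n : ℕ) : Set Ω :=
  {ω | K (n+1) ω = K n ω + 1 ∧ B 1 (n+1) ω = B 1 n ω + 1 ∧
        ∀ s, 2 ≤ s → B s (n+1) ω = B s n ω}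

/-- grow event -/
def evG (K : ℕ → Ω → ℕ) (B : ℕ → ℕ → Ω → ℕ) (n r : ℕ) : Set Ω :=
  {ω | K (n+1) ω = K n ω ∧ B r (n+1) ω + 1 = B r n ω ∧
        B (r+1) (n+1) ω = B (r+1) n ω + 1 ∧
        ∀ s, 1 ≤ s → s ≠ r → s ≠ r + 1 → B s (n+1) ω = B s n ω}

lemma evN_meas (hEP : IsEwensPitman α θ μ F K B) (n : ℕ) : MeasurableSet (evN K B n) := by
  have hK : ∀ n, Measurable (K n) := fun n => (hEP.meas_K n).mono (F.le n) le_rfl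
  have hB : ∀ r n, Measurable (B r n) := fun r n => (hEP.meas_B r n).mono (F.le n) le_rfl
  have h1 := measurableSet_eq_fun (hK (n+1)) ((hK n).add_const 1)
  have h2 := measurableSet_eq_fun (hB 1 (n+1)) ((hB 1 n).add_const 1)
  have h3 : MeasurableSet {ω | ∀ s, 2 ≤ s → B s (n+1) ω = B s n ω} := by
    simp only [Set.setOf_forall]
    exact MeasurableSet.iInter fun s => MeasurableSet.iInter fun _ =>
      measurableSet_eq_fun (hB s (n+1)) (hB s n)
  exact h1.inter (h2.inter h3)

lemma evG_meas (hEP : IsEwensPitman α θ μ F K B) (n r : ℕ) : MeasurableSet (evG K B n r) := by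
  have hK : ∀ n, Measurable (K n) := fun n => (hEP.meas_K n).mono (F.le n) le_rfl
  have hB : ∀ r n, Measurable (B r n) := fun r n => (hEP.meas_B r n).mono (F.le n) le_rfl
  have h1 := measurableSet_eq_fun (hK (n+1)) (hK n)
  have h2 := measurableSet_eq_fun ((hB r (n+1)).add_const 1) (hB r n)
  have h2' := measurableSet_eq_fun (hB (r+1) (n+1)) ((hB (r+1) n).add_const 1)
  have h3 : MeasurableSet {ω | ∀ s, 1 ≤ s → s ≠ r → s ≠ r + 1 → B s (n+1) ω = B s n ω} := by
    simp only [Set.setOf_forall]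
    exact MeasurableSet.iInter fun s => MeasurableSet.iInter fun _ => MeasurableSet.iInter fun _ =>
      MeasurableSet.iInter fun _ => measurableSet_eq_fun (hB s (n+1)) (hB s n)
  exact h1.inter (h2.inter (h2'.inter h3))

lemma evNG (n r : ℕ) (ω : Ω) (h : ω ∈ evN K B n) : ω ∉ evG K B n r := by
  intro h'
  have h1 := h.1
  have h2 := h'.1
  omega

lemma evGG (n r s : ℕ) (hr : 1 ≤ r) (hs : 1 ≤ s) (hrs : r ≠ s) (ω : Ω) (h : ω ∈ evG K B n r) :
    ω ∉ evG K B n s := by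
  intro h'
  rcases lt_or_gt_of_ne hrs with h1 | h1
  · have h2 := h'.2.2.2 r hr (by omega) (by omega)
    have h3 := h.2.1
    omega
  · have h2 := h.2.2.2 s hs (by omega) (by omega)
    have h3 := h'.2.1
    omega

lemma EP_cover (hα1 : α < 1) (hθ : 0 < α + θ)
    (hEP : IsEwensPitman α θ μ F K B) (n : ℕ) (hn : 1 ≤ n) :
    ∀ᵐ ω ∂μ, ω ∈ evN K B n ∨ ∃ r, 1 ≤ r ∧ ω ∈ evG K B n r := by
  have := hEP.prob
  have hnθ : 0 < (n:ℝ) + θ := by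
    have : (1:ℝ) ≤ n := by exact_mod_cast hn
    linarith
  set S : Ω → ℝ := fun ω => Set.indicator (evN K B n) (fun _ => (1:ℝ)) ω
    + ∑ r ∈ Finset.Icc 1 n, Set.indicator (evG K B n r) (fun _ => (1:ℝ)) ω with hS
  have iN : Integrable (Set.indicator (evN K B n) (fun _ => (1:ℝ))) μ :=
    (integrable_const (1:ℝ)).indicator (evN_meas hEP n)
  have iG : ∀ r, Integrable (Set.indicator (evG K B n r) (fun _ => (1:ℝ))) μ := fun r =>
    (integrable_const (1:ℝ)).indicator (evG_meas hEP n r)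
  have iS : Integrable S μ := iN.add (integrable_finset_sum _ fun r _ => iG r)
  have hle : ∀ ω, S ω ≤ 1 := by
    intro ω
    simp only [hS]
    by_cases h : ω ∈ evN K B n
    · rw [Finset.sum_eq_zero]
      · simp [h]
      · intro r _
        simp [evNG n r ω h]
    · rw [Set.indicator_of_notMem h, zero_add]
      by_cases h2 : ∃ r ∈ Finset.Icc 1 n, ω ∈ evG K B n r
      · obtain ⟨r, hr, hω⟩ := h2
        rw [Finset.sum_eq_single_of_mem r hr]
        · simp [hω]
        · intro s hs hsr
          exact Set.indicator_of_notMem (evGG n r s (Finset.mem_Icc.1 hr).1 (Finset.mem_Icc.1 hs).1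
            (Ne.symm hsr) ω hω) _
      · push Not at h2
        rw [Finset.sum_eq_zero]
        · norm_num
        · intro r hr
          simp [h2 r hr]
  have hintS : ∫ ω, S ω ∂μ = 1 := by
    simp only [hS]
    rw [integral_add iN (integrable_finset_sum _ fun r _ => iG r),
      integral_finset_sum _ fun r _ => iG r]
    rw [← integral_condExp (μ := μ) (F.le n)]
    have e1 : ∀ r, ∫ ω, Set.indicator (evG K B n r) (fun _ => (1:ℝ)) ω ∂μ
        = ∫ ω, (μ[Set.indicator (evG K B n r) (fun _ => (1:ℝ)) | F n]) ω ∂μ :=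
      fun r => (integral_condExp (μ := μ) (F.le n)).symm
    simp only [e1]
    rw [← integral_finset_sum _ fun r _ => integrable_condExp,
      ← integral_add integrable_condExp (integrable_finset_sum _ fun r _ => integrable_condExp)]
    have hall : ∀ᵐ ω ∂μ, ∀ r, 1 ≤ r →
        (μ[Set.indicator (evG K B n r) (fun _ => (1:ℝ)) | F n]) ω
          = (((r : ℝ) - α) * (B r n ω : ℝ)) / ((n : ℝ) + θ) := by
      rw [ae_all_iff]
      intro r
      by_cases hr : 1 ≤ r
      · filter_upwards [hEP.trans_grow n hn r hr] with ω h _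
        exact h
      · exact ae_of_all _ fun ω h => absurd h hr
    have e2 : ∀ᵐ ω ∂μ, (μ[Set.indicator (evN K B n) (fun _ => (1:ℝ)) | F n]) ω
        + ∑ r ∈ Finset.Icc 1 n, (μ[Set.indicator (evG K B n r) (fun _ => (1:ℝ)) | F n]) ω = 1 := by
      filter_upwards [hall, hEP.trans_new n hn, hEP.sum_blocks n hn, hEP.sum_sizes n hn]
        with ω h1 h2 h3 h4
      have h2' : (μ[Set.indicator (evN K B n) (fun _ => (1:ℝ)) | F n]) ω
        = (α * (K n ω : ℝ) + θ) / ((n : ℝ) + θ) := h2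
      rw [h2', Finset.sum_congr rfl fun r hr => h1 r (Finset.mem_Icc.1 hr).1, ← Finset.sum_div,
        ← add_div, div_eq_one_iff_eq hnθ.ne']
      have h3' : (K n ω : ℝ) = ∑ r ∈ Finset.Icc 1 n, (B r n ω : ℝ) := by exact_mod_cast h3
      have h4' : (n : ℝ) = ∑ r ∈ Finset.Icc 1 n, (r : ℝ) * (B r n ω : ℝ) := by exact_mod_cast h4
      simp only [sub_mul, Finset.sum_sub_distrib, ← Finset.mul_sum]
      rw [← h3', ← h4']
      ring
    rw [integral_congr_ae e2]
    simp
  have h0 : ∫ ω, (1 - S ω) ∂μ = 0 := by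
    rw [integral_sub (integrable_const 1) iS, hintS]
    simp
  rw [integral_eq_zero_iff_of_nonneg (fun ω => sub_nonneg.2 (hle ω))
    ((integrable_const 1).sub iS)] at h0
  filter_upwards [h0] with ω hω
  by_contra hc
  push Not at hc
  have : S ω = 0 := by
    simp only [hS]
    rw [Set.indicator_of_notMem hc.1, Finset.sum_eq_zero]
    · norm_num
    · intro r hr
      exact Set.indicator_of_notMem (hc.2 r (Finset.mem_Icc.1 hr).1) _
  simp [this] at hω

lemma EP_step [CompleteSpace E] (hα1 : α < 1) (hθ : 0 < α + θ)
    (hEP : IsEwensPitman α θ μ F K B) (n : ℕ) (hn : 1 ≤ n) (f : ℕ → ℕ → E) :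
    ∫ ω, f (K (n+1) ω) (B 1 (n+1) ω) ∂μ = ∫ ω, (pr α θ n (K n ω) • f (K n ω + 1) (B 1 n ω + 1)
      + qr α θ n (B 1 n ω) • f (K n ω) (B 1 n ω - 1)
      + (1 - pr α θ n (K n ω) - qr α θ n (B 1 n ω)) • f (K n ω) (B 1 n ω)) ∂μ := by
  have := hEP.prob
  obtain ⟨iN, hN⟩ := EP_pull hEP n hn (fun k b => f (k+1) (b+1) - f k b) (evN K B n)
    (evN_meas hEP n) _ (hEP.trans_new n hn)
  obtain ⟨iG, hG⟩ := EP_pull hEP n hn (fun k b => f k (b-1) - f k b) (evG K B n 1)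
    (evG_meas hEP n 1) _ (hEP.trans_grow n hn 1 le_rfl)
  have i0 := EP_int hEP n hn f
  have e1 : ∫ ω, f (K (n+1) ω) (B 1 (n+1) ω) ∂μ =
      ∫ ω, (Set.indicator (evN K B n) (fun _ => (1:ℝ)) ω •
          (f (K n ω + 1) (B 1 n ω + 1) - f (K n ω) (B 1 n ω))
        + Set.indicator (evG K B n 1) (fun _ => (1:ℝ)) ω •
          (f (K n ω) (B 1 n ω - 1) - f (K n ω) (B 1 n ω))
        + f (K n ω) (B 1 n ω)) ∂μ := by
    refine integral_congr_ae ?_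
    filter_upwards [EP_cover hα1 hθ hEP n hn] with ω hω
    rcases hω with h | ⟨r, hr, h⟩
    · rw [Set.indicator_of_mem h, Set.indicator_of_notMem (evNG n 1 ω h), h.1, h.2.1]
      simp
    · have hnN : ω ∉ evN K B n := fun h' => evNG n r ω h' h
      by_cases hr1 : r = 1
      · subst hr1
        rw [Set.indicator_of_notMem hnN, Set.indicator_of_mem h, h.1]
        have : B 1 (n+1) ω = B 1 n ω - 1 := by have := h.2.1; omega
        rw [this]
        simp
      · rw [Set.indicator_of_notMem hnN,
          Set.indicator_of_notMem (evGG n r 1 hr le_rfl hr1 ω h), h.1,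
          h.2.2.2 1 le_rfl (by omega) (by omega)]
        simp
  have iNG : Integrable (fun ω => Set.indicator (evN K B n) (fun _ => (1:ℝ)) ω •
          (f (K n ω + 1) (B 1 n ω + 1) - f (K n ω) (B 1 n ω))
        + Set.indicator (evG K B n 1) (fun _ => (1:ℝ)) ω •
          (f (K n ω) (B 1 n ω - 1) - f (K n ω) (B 1 n ω))) μ := iN.add iG
  rw [e1, integral_add iNG i0, integral_add iN iG, hN, hG]
  have j1 : Integrable (fun ω => ((α * (K n ω : ℝ) + θ) / ((n : ℝ) + θ)) •
    (f (K n ω + 1) (B 1 n ω + 1) - f (K n ω) (B 1 n ω))) μ :=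
    EP_int hEP n hn (fun k b => ((α * (k : ℝ) + θ) / ((n : ℝ) + θ)) • (f (k + 1) (b + 1) - f k b))
  have j2 : Integrable (fun ω => ((((1:ℕ) : ℝ) - α) * (B 1 n ω : ℝ) / ((n : ℝ) + θ)) •
    (f (K n ω) (B 1 n ω - 1) - f (K n ω) (B 1 n ω))) μ :=
    EP_int hEP n hn (fun k b => ((((1:ℕ) : ℝ) - α) * (b : ℝ) / ((n : ℝ) + θ)) •
      (f k (b - 1) - f k b))
  rw [← integral_add j1 j2]
  have j3 : Integrable (fun ω => ((α * (K n ω : ℝ) + θ) / ((n : ℝ) + θ)) •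
    (f (K n ω + 1) (B 1 n ω + 1) - f (K n ω) (B 1 n ω)) +
    ((((1:ℕ) : ℝ) - α) * (B 1 n ω : ℝ) / ((n : ℝ) + θ)) •
    (f (K n ω) (B 1 n ω - 1) - f (K n ω) (B 1 n ω))) μ := j1.add j2
  rw [← integral_add j3 i0]
  congr 1
  ext ω
  simp only [pr, qr, Nat.cast_one]
  module

end EP

section EP2
variable {α θ : ℝ} {Ω : Type*} {mΩ : MeasurableSpace Ω}
    {μ : Measure Ω} {F : Filtration ℕ mΩ} {K : ℕ → Ω → ℕ} {B : ℕ → ℕ → Ω → ℕ}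

lemma EP_D (hα0 : 0 < α) (hα1 : α < 1) (hθ : 0 < α + θ) (hEP : IsEwensPitman α θ μ F K B) :
    Tendsto (fun n => ∫ ω, 1 / (K n ω : ℝ) ∂μ) atTop (𝓝 0) := by
  obtain ⟨c, hc, hc1, h⟩ := lyap1 α θ hα0 hα1 hθ
  refine rec_tendsto _ (fun _ => 0) c hc hc1 (fun n => integral_nonneg fun ω => by positivity) ?_
    tendsto_const_nhds
  intro n hn
  rw [EP_step hα1 hθ hEP n hn (fun k _ => 1 / (k:ℝ)), zero_div, add_zero, ← integral_const_mul]
  refine integral_mono_ae (EP_int hEP n hn (fun k b => pr α θ n k • (1 / ((k+1 : ℕ) : ℝ))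
    + qr α θ n b • (1 / (k : ℝ)) + (1 - pr α θ n k - qr α θ n b) • (1 / (k : ℝ))))
    (EP_int hEP n hn (fun k b => (1 - c / n) * (1 / (k : ℝ)))) ?_
  filter_upwards [EP_bounds hEP n hn] with ω hω
  simpa only [smul_eq_mul] using h n (K n ω) (B 1 n ω) hω.1 hω.2.1

lemma EP_M (hα0 : 0 < α) (hα1 : α < 1) (hθ : 0 < α + θ) (hEP : IsEwensPitman α θ μ F K B)
    (n : ℕ) (hn : 1 ≤ n) :
    ∫ ω, zf α (K n ω) (B 1 n ω) ^ 2 ∂μ ≤ max 1 ((6 + 3 * |θ|) / (1 - α)) := by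
  have := hEP.prob
  have ha : 0 < 1 - α := by linarith
  obtain ⟨M, hM⟩ : ∃ M, M = max 1 ((6 + 3 * |θ|) / (1 - α)) := ⟨_, rfl⟩
  rw [← hM]
  have hM1 : 1 ≤ M := hM ▸ le_max_left _ _
  have hM2 : (6 + 3 * |θ|) ≤ (1 - α) * M := by
    have : (6 + 3 * |θ|) / (1 - α) ≤ M := hM ▸ le_max_right _ _
    rw [div_le_iff₀ ha] at this
    linarith
  induction n, hn using Nat.le_induction with
  | base =>
    have : ∫ ω, zf α (K 1 ω) (B 1 1 ω) ^ 2 ∂μ = ∫ ω, (1 - α) ^ 2 ∂μ := by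
      refine integral_congr_ae ?_
      filter_upwards [hEP.init_K, hEP.init_B1] with ω h1 h2
      rw [h1, h2]
      simp [zf]
    rw [this]
    simp only [integral_const, probReal_univ, one_smul]
    exact (pow_le_one₀ ha.le (by linarith)).trans hM1
  | succ n hn ih =>
    have hn1 : (1:ℝ) ≤ n := by exact_mod_cast hn
    have hnθ : 1 - α ≤ (n:ℝ) + θ := by linarith
    have hnθ0 : 0 < (n:ℝ) + θ := by linarith
    rw [EP_step hα1 hθ hEP n hn (fun k b => zf α k b ^ 2)]
    have hi := EP_int hEP n hn (fun k b => zf α k b ^ 2)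
    calc _ ≤ ∫ ω, ((6 + 3 * |θ|) / (n + θ)
          + (1 - (1 - α) / (n + θ)) * zf α (K n ω) (B 1 n ω) ^ 2) ∂μ := by
          refine integral_mono_ae (EP_int hEP n hn (fun k b => pr α θ n k • zf α (k+1) (b+1) ^ 2
            + qr α θ n b • zf α k (b-1) ^ 2 + (1 - pr α θ n k - qr α θ n b) • zf α k b ^ 2))
            (EP_int hEP n hn (fun k b => (6 + 3 * |θ|) / (n + θ)
              + (1 - (1 - α) / (n + θ)) * zf α k b ^ 2)) ?_
          filter_upwards [EP_bounds hEP n hn] with ω hω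
          have h := lyap2 α θ hα0 hα1 hθ n (K n ω) (B 1 n ω) hω.1 hω.2.1 hω.2.2
          simp only [smul_eq_mul]
          refine h.trans (le_of_eq ?_)
          ring
      _ = (6 + 3 * |θ|) / (n + θ)
          + (1 - (1 - α) / (n + θ)) * ∫ ω, zf α (K n ω) (B 1 n ω) ^ 2 ∂μ := by
          rw [integral_add (integrable_const _) (hi.const_mul _), integral_const_mul]
          simp
      _ ≤ ((1 - α) * M) / (n + θ) + (1 - (1 - α) / (n + θ)) * M := by
          have : 0 ≤ 1 - (1 - α) / (n + θ) := by
            rw [sub_nonneg, div_le_one hnθ0]; exact hnθ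
          gcongr
      _ = M := by ring

lemma amgm_aux (z k η : ℝ) (hk : 1 ≤ k) (hη : 0 < η) :
    (1 + |z|) / Real.sqrt k ≤ 2 * η * (1 + z ^ 2) + 1 / η * (1 / k) := by
  have hk0 : 0 < k := by linarith
  obtain ⟨u, hu⟩ : ∃ u, u = 1 / Real.sqrt k := ⟨_, rfl⟩
  have hu2 : 1 / k = u ^ 2 := by
    rw [hu, div_pow, Real.sq_sqrt hk0.le, one_pow]
  have e : (1 + |z|) / Real.sqrt k = (1 + |z|) * u := by rw [hu]; ring
  rw [e, hu2]
  have h1 : (1 + |z|) ^ 2 ≤ 2 * (1 + z ^ 2) := by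
    nlinarith [sq_abs z, sq_nonneg (1 - |z|)]
  have h2 : (1 + |z|) * u ≤ η * (1 + |z|) ^ 2 + 1 / η * u ^ 2 := by
    have h4 : 0 ≤ η * (1 + |z|) ^ 2 - (1 + |z|) * u + 1 / η * u ^ 2 := by
      have : η * (1 + |z|) ^ 2 - (1 + |z|) * u + 1 / η * u ^ 2
        = ((η * (1 + |z|) - u / 2) ^ 2 + 3 / 4 * u ^ 2) / η := by
        field_simp
        ring
      rw [this]
      positivity
    linarith
  have h5 := mul_le_mul_of_nonneg_left h1 hη.le
  linarith

lemma EP_eps (hα0 : 0 < α) (hα1 : α < 1) (hθ : 0 < α + θ) (hEP : IsEwensPitman α θ μ F K B) :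
    Tendsto (fun n => ∫ ω, (1 + |zf α (K n ω) (B 1 n ω)|) / Real.sqrt (K n ω : ℝ) ∂μ)
      atTop (𝓝 0) := by
  have := hEP.prob
  obtain ⟨M, hM⟩ : ∃ M, M = max 1 ((6 + 3 * |θ|) / (1 - α)) := ⟨_, rfl⟩
  have hD := EP_D hα0 hα1 hθ hEP
  have hub : Tendsto (fun n => (2 * (1 + M) + 1) * Real.sqrt (∫ ω, 1 / (K n ω : ℝ) ∂μ))
      atTop (𝓝 0) := by
    have := ((Real.continuous_sqrt.tendsto 0).comp hD).const_mul (2 * (1 + M) + 1)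
    simpa using this
  refine squeeze_zero' (Eventually.of_forall fun n => integral_nonneg fun ω => by positivity) ?_ hub
  filter_upwards [eventually_ge_atTop 1] with n hn
  have hn1 : (1:ℝ) ≤ n := by exact_mod_cast hn
  have iD := EP_int hEP n hn (fun k _ => 1 / (k:ℝ))
  have iz := EP_int hEP n hn (fun k b => zf α k b ^ 2)
  have hDpos : 0 < ∫ ω, 1 / (K n ω : ℝ) ∂μ := by
    have : ∫ ω, 1 / (n:ℝ) ∂μ ≤ ∫ ω, 1 / (K n ω : ℝ) ∂μ := by
      refine integral_mono_ae (integrable_const _) iD ?_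
      filter_upwards [EP_bounds hEP n hn] with ω hω
      have h1 : (1:ℝ) ≤ K n ω := by exact_mod_cast hω.1
      have h2 : (K n ω : ℝ) ≤ n := by exact_mod_cast hω.2.1
      exact one_div_le_one_div_of_le (by linarith) h2
    simp only [integral_const, probReal_univ, one_smul] at this
    have h0 : 0 < 1 / (n:ℝ) := by positivity
    linarith
  obtain ⟨D, hDd⟩ : ∃ D, D = ∫ ω, 1 / (K n ω : ℝ) ∂μ := ⟨_, rfl⟩
  obtain ⟨η, hη⟩ : ∃ η, η = Real.sqrt D := ⟨_, rfl⟩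
  have hη0 : 0 < η := by rw [hη, hDd]; exact Real.sqrt_pos.2 hDpos
  have hηD : η * η = D := by rw [hη]; exact Real.mul_self_sqrt (hDd ▸ hDpos.le)
  rw [← hDd, ← hη]
  have iz2 : Integrable (fun ω => 2 * η * (1 + zf α (K n ω) (B 1 n ω) ^ 2)) μ :=
    EP_int hEP n hn (fun k b => 2 * η * (1 + zf α k b ^ 2))
  calc _ ≤ ∫ ω, (2 * η * (1 + zf α (K n ω) (B 1 n ω) ^ 2) + 1 / η * (1 / (K n ω : ℝ))) ∂μ := by
        refine integral_mono_ae (EP_int hEP n hn (fun k b => (1 + |zf α k b|) / Real.sqrt (k:ℝ)))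
          (EP_int hEP n hn (fun k b => 2 * η * (1 + zf α k b ^ 2) + 1 / η * (1 / (k:ℝ)))) ?_
        filter_upwards [EP_bounds hEP n hn] with ω hω
        exact amgm_aux _ _ _ (by exact_mod_cast hω.1) hη0
    _ = 2 * η * (1 + ∫ ω, zf α (K n ω) (B 1 n ω) ^ 2 ∂μ) + 1 / η * D := by
        rw [integral_add iz2 (iD.const_mul _), integral_const_mul, integral_const_mul,
          integral_add (integrable_const _) iz, hDd]
        simp
    _ ≤ 2 * η * (1 + M) + 1 / η * D := by
        have := EP_M hα0 hα1 hθ hEP n hn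
        rw [← hM] at this
        gcongr
    _ = (2 * (1 + M) + 1) * η := by
        rw [← hηD]
        field_simp

lemma EP_char (hα0 : 0 < α) (hα1 : α < 1) (hθ : 0 < α + θ) (hEP : IsEwensPitman α θ μ F K B)
    (t : ℝ) (ht : 0 ≤ t) : ∃ a : ℕ → ℝ, Tendsto a atTop (𝓝 0) ∧ ∀ n, 1 ≤ n → ∀ s : ℝ, |s| ≤ t →
      ‖∫ ω, hh α s (K n ω) (B 1 n ω) ∂μ - 1‖ ≤ |s| * a n := by
  have := hEP.prob
  have ha : 0 < 1 - α := by linarith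
  obtain ⟨C, hC⟩ : ∃ C, C = Real.exp (t ^ 2) * stepConst (|θ| / (1 - α)) t := ⟨_, rfl⟩
  have hC0 : 0 ≤ C := by
    have : 0 ≤ |θ| / (1 - α) := by positivity
    rw [hC, stepConst]
    positivity
  obtain ⟨β, hβ⟩ : ∃ β, β = 1 - α / 2 := ⟨_, rfl⟩
  have hβ0 : 0 < β := by linarith
  have hβ1 : β ≤ 1 := by linarith
  set ε : ℕ → ℝ := fun n => ∫ ω, (1 + |zf α (K n ω) (B 1 n ω)|) / Real.sqrt (K n ω : ℝ) ∂μ with hε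
  have hεt : Tendsto ε atTop (𝓝 0) := EP_eps hα0 hα1 hθ hEP
  have hε0 : ∀ n, 0 ≤ ε n := fun n => integral_nonneg fun ω => by positivity
  set a : ℕ → ℝ := fun n => Nat.rec ((1 + t) * Real.exp (t * (1 + t)))
    (fun n x => (1 - β / n) * x + C * ε n / n) n with hadef
  have ha0 : a 0 = (1 + t) * Real.exp (t * (1 + t)) := rfl
  have ha1 : ∀ n, a (n+1) = (1 - β / n) * a n + C * ε n / n := fun n => rfl
  have hβn : ∀ n : ℕ, 0 ≤ 1 - β / n ∧ 1 - β / n ≤ 1 := by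
    intro n
    rcases Nat.eq_zero_or_pos n with h | h
    · simp [h]
    · have hn1 : (1:ℝ) ≤ n := by exact_mod_cast h
      constructor
      · rw [sub_nonneg, div_le_one (by linarith)]; linarith
      · have : 0 ≤ β / n := by positivity
        linarith
  have hann : ∀ n, 0 ≤ a n := by
    intro n
    induction n with
    | zero => rw [ha0]; positivity
    | succ n ih =>
      rw [ha1]
      have h1 := mul_nonneg (hβn n).1 ih
      have h2 : 0 ≤ C * ε n / n := div_nonneg (mul_nonneg hC0 (hε0 n)) (by positivity)
      linarith
  refine ⟨a, rec_tendsto a (fun n => C * ε n) β hβ0 hβ1 hann (fun n _ => (ha1 n).le)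
    (by simpa using hεt.const_mul C), ?_⟩
  intro n hn
  induction n, hn using Nat.le_induction with
  | base =>
    intro s hs
    have e : ∫ ω, hh α s (K 1 ω) (B 1 1 ω) ∂μ = ∫ ω, hh α s 1 1 ∂μ := by
      refine integral_congr_ae ?_
      filter_upwards [hEP.init_K, hEP.init_B1] with ω h1 h2
      rw [h1, h2]
    have e1 : a 1 = (1 + t) * Real.exp (t * (1 + t)) := by
      have := ha1 0
      simpa [ha0] using this
    rw [e, e1]
    simp only [integral_const, probReal_univ, one_smul]
    obtain ⟨w, hw⟩ : ∃ w : ℂ, w = Complex.I * ((s * zf α 1 1 : ℝ) : ℂ)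
      + ((α * (1 - α) * s ^ 2 / 2 : ℝ) : ℂ) := ⟨_, rfl⟩
    have hz : zf α 1 1 = 1 - α := by simp [zf]
    have hwn : ‖w‖ ≤ |s| * (1 + t) := by
      rw [hw, hz]
      refine (norm_add_le _ _).trans ?_
      rw [norm_mul, Complex.norm_I, one_mul, Complex.norm_real, Complex.norm_real,
        Real.norm_eq_abs, Real.norm_eq_abs, abs_mul, abs_of_pos ha,
        abs_of_nonneg (by positivity : 0 ≤ α * (1 - α) * s ^ 2 / 2)]
      have h1 : |s| * (1 - α) ≤ |s| * 1 := by gcongr; linarith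
      have h2 : α * (1 - α) ≤ 1 := mul_le_one₀ hα1.le ha.le (by linarith)
      have h3 : s ^ 2 ≤ |s| * t := by
        rw [← sq_abs, sq]; gcongr
      have h4 : α * (1 - α) * s ^ 2 ≤ 1 * s ^ 2 := by gcongr
      have h5 := sq_nonneg s
      linarith
    have hwt : ‖w‖ ≤ t * (1 + t) := hwn.trans (by gcongr)
    have h6 := Complex.norm_exp_sub_sum_le_norm_mul_exp w 1
    simp only [Finset.range_one, Finset.sum_singleton, pow_zero, Nat.factorial_zero, Nat.cast_one,
      div_one, pow_one] at h6
    rw [hh, ← hw]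
    calc _ ≤ ‖w‖ * Real.exp ‖w‖ := h6
      _ ≤ (|s| * (1 + t)) * Real.exp (t * (1 + t)) := by gcongr
      _ = _ := by ring
  | succ n hn ih =>
    intro s hs
    have hn1 : (1:ℝ) ≤ n := by exact_mod_cast hn
    obtain ⟨s', hs'⟩ : ∃ s', s' = s * (1 - β / n) := ⟨_, rfl⟩
    have hs'a : |s'| = |s| * (1 - β / n) := by
      rw [hs', abs_mul, abs_of_nonneg (hβn n).1]
    have hs't : |s'| ≤ t := by
      rw [hs'a]
      exact (mul_le_of_le_one_right (abs_nonneg s) (hβn n).2).trans hs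
    have h1 := ih s' hs't
    rw [EP_step hα1 hθ hEP n hn (fun k b => hh α s k b)]
    have ig := EP_int hEP n hn (fun k b => pr α θ n k • hh α s (k+1) (b+1)
            + qr α θ n b • hh α s k (b-1) + (1 - pr α θ n k - qr α θ n b) • hh α s k b)
    have ih' := EP_int hEP n hn (fun k b => hh α s' k b)
    have h2 : ‖∫ ω, (pr α θ n (K n ω) • hh α s (K n ω + 1) (B 1 n ω + 1)
      + qr α θ n (B 1 n ω) • hh α s (K n ω) (B 1 n ω - 1)
      + (1 - pr α θ n (K n ω) - qr α θ n (B 1 n ω)) • hh α s (K n ω) (B 1 n ω)) ∂μ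
      - ∫ ω, hh α s' (K n ω) (B 1 n ω) ∂μ‖ ≤ C * |s| / n * ε n := by
      rw [← integral_sub ig ih', hε]
      simp only []
      rw [← integral_const_mul]
      refine norm_integral_le_of_norm_le (EP_int hEP n hn (fun k b =>
        C * |s| / n * ((1 + |zf α k b|) / Real.sqrt (k:ℝ)))) ?_
      filter_upwards [EP_bounds hEP n hn] with ω hω
      have h := step_final α θ s t hα0 hα1 hθ hs n (K n ω) (B 1 n ω) hω.1 hω.2.1 hω.2.2
      rw [← hC, ← hβ, ← hs'] at h
      simp only [Complex.real_smul]
      push_cast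
      refine h.trans (le_of_eq ?_)
      rw [mul_comm (n:ℝ), ← div_div]
      ring
    calc _ ≤ C * |s| / n * ε n + |s'| * a n := by
          rw [← sub_add_sub_cancel _ (∫ ω, hh α s' (K n ω) (B 1 n ω) ∂μ) 1]
          exact (norm_add_le _ _).trans (add_le_add h2 h1)
      _ = _ := by rw [hs'a, ha1]; ring

end EP2

theorem estimator_clt (α θ : ℝ) (hα0 : 0 < α) (hα1 : α < 1) (hθ : 0 < α + θ)
    {Ω : Type*} [mΩ : MeasurableSpace Ω] (μ : Measure Ω) (F : Filtration ℕ mΩ)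
    (K : ℕ → Ω → ℕ) (B : ℕ → ℕ → Ω → ℕ) (hEP : IsEwensPitman α θ μ F K B) :
    ∀ f : BoundedContinuousFunction ℝ ℝ,
      Tendsto
        (fun n => ∫ ω, f (Real.sqrt (K n ω : ℝ) * ((B 1 n ω : ℝ) / (K n ω : ℝ) - α)) ∂μ)
        atTop
        (𝓝 (∫ x, f x ∂(gaussianReal 0 (Real.toNNReal (α * (1 - α)))))) := by
  have := hEP.prob
  have ha : 0 < 1 - α := by linarith
  have hm : ∀ n, Measurable (fun ω => zf α (K n ω) (B 1 n ω)) := fun n =>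
    ((EP_sm hEP n (fun k b => zf α k b)).mono (F.le n)).measurable
  have hpm : ∀ n, IsProbabilityMeasure (μ.map (fun ω => zf α (K n ω) (B 1 n ω))) := fun n =>
    Measure.isProbabilityMeasure_map (hm n).aemeasurable
  let P : ℕ → ProbabilityMeasure ℝ := fun n => ⟨μ.map (fun ω => zf α (K n ω) (B 1 n ω)), hpm n⟩
  let G : ProbabilityMeasure ℝ := ⟨gaussianReal 0 (Real.toNNReal (α * (1 - α))), inferInstance⟩
  have hT : Tendsto P atTop (𝓝 G) := by
    apply ProbabilityMeasure.tendsto_of_tendsto_charFun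
    intro s
    have hG : charFun (G : Measure ℝ) s = Complex.exp (-((α * (1 - α) * s ^ 2 / 2 : ℝ) : ℂ)) := by
      change charFun (gaussianReal 0 (Real.toNNReal (α * (1 - α)))) s = _
      rw [charFun_gaussianReal, Real.coe_toNNReal _ (by positivity)]
      push_cast
      congr 1
      ring
    have hP : ∀ n, charFun (P n : Measure ℝ) s = Complex.exp (-((α * (1 - α) * s ^ 2 / 2 : ℝ) : ℂ))
        * ∫ ω, hh α s (K n ω) (B 1 n ω) ∂μ := by
      intro n
      change charFun (μ.map (fun ω => zf α (K n ω) (B 1 n ω))) s = _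
      rw [charFun_apply_real, integral_map (hm n).aemeasurable
        (Continuous.aestronglyMeasurable (by fun_prop)), ← integral_const_mul]
      congr 1
      ext ω
      rw [hh, ← Complex.exp_add]
      congr 1
      push_cast
      ring
    obtain ⟨a, ha0, hab⟩ := EP_char hα0 hα1 hθ hEP |s| (abs_nonneg s)
    have hlim : Tendsto (fun n => ∫ ω, hh α s (K n ω) (B 1 n ω) ∂μ) atTop (𝓝 1) := by
      rw [tendsto_iff_norm_sub_tendsto_zero]
      refine squeeze_zero' (Eventually.of_forall fun n => norm_nonneg _) ?_
        (by simpa using ha0.const_mul |s|)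
      filter_upwards [eventually_ge_atTop 1] with n hn
      exact hab n hn s le_rfl
    simp only [hG, hP]
    have h9 := hlim.const_mul (Complex.exp (-((α * (1 - α) * s ^ 2 / 2 : ℝ) : ℂ)))
    rw [mul_one] at h9
    exact h9
  intro f
  have h := (ProbabilityMeasure.tendsto_iff_forall_integral_tendsto.1 hT) f
  refine h.congr fun n => ?_
  change ∫ x, f x ∂(μ.map (fun ω => zf α (K n ω) (B 1 n ω))) = _
  rw [integral_map (hm n).aemeasurable f.continuous.aestronglyMeasurable]
  rfl

end
end
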